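/- arXiv:2603.16308 — 2 statements merged into one kernel-verified Lean document; each statement's English description precedes it below -/
import Mathlib

section
/- Every r ∈ ROQ(ℝ³) satisfies an affine-complete formula in 𝔐³: there exists an L_{conv,≤}-formula φ(x) in one free variable such that 𝔐³ ⊨ φ[r], and for any r', r'' ∈ ROQ(ℝ³) with 𝔐³ ⊨ φ[r'] and 𝔐³ ⊨ φ[r''] there exists an affine transformation τ of ℝ³ with τ(r') = r''. -/
open FirstOrder

/-- A rational open half-space in ℝ^n: `{x | c·x < d}` with `c ∈ ℚ^n` nonzero, `d ∈ ℚ`. -/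
def IsRatHalfSpace (n : ℕ) (s : Set (Fin n → ℝ)) : Prop :=
  ∃ (c : Fin n → ℚ) (d : ℚ), c ≠ 0 ∧
    s = {x : Fin n → ℝ | (∑ i, (c i : ℝ) * x i) < (d : ℝ)}

/-- Membership in the Boolean subalgebra `ROQ(ℝ^n)` of the Boolean algebra of regular open
sets generated by the rational open half-spaces, with Boolean operations
`a·b = a ∩ b`, `a + b = int(cl(a ∪ b))`, `-a = int(ℝ^n ∖ a)`, `0 = ∅`, `1 = univ`. -/
inductive InROQ (n : ℕ) : Set (Fin n → ℝ) → Prop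
  | bot : InROQ n ∅
  | top : InROQ n Set.univ
  | halfspace (s : Set (Fin n → ℝ)) : IsRatHalfSpace n s → InROQ n s
  | inf (s t : Set (Fin n → ℝ)) : InROQ n s → InROQ n t → InROQ n (s ∩ t)
  | sup (s t : Set (Fin n → ℝ)) : InROQ n s → InROQ n t →
      InROQ n (interior (closure (s ∪ t)))
  | compl (s : Set (Fin n → ℝ)) : InROQ n s → InROQ n (interior sᶜ)

/-- `ROQ(ℝ^n)` as a set of subsets of ℝ^n. -/
def ROQ (n : ℕ) : Set (Set (Fin n → ℝ)) := {s | InROQ n s}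

/-- The domain of the structure 𝔐^n: the regular open rational polytopes. -/
def ROQel (n : ℕ) : Type := {s : Set (Fin n → ℝ) // InROQ n s}

/-- Relation symbols of the language L_{conv,≤}: one unary (`conv`), one binary (`≤`). -/
def LconvRel : ℕ → Type
  | 1 => Unit
  | 2 => Unit
  | _ => Empty

/-- The first-order language L_{conv,≤} with no function symbols, a unary relation symbol
`conv` and a binary relation symbol `≤`. -/
def Lconv : Language := ⟨fun _ => Empty, LconvRel⟩

/-- The structure 𝔐^n: domain ROQ(ℝ^n), `≤` interpreted as inclusion and `conv`
as convexity. -/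
instance MStructure (n : ℕ) : Lconv.Structure (ROQel n) where
  funMap := fun f _ => f.elim
  RelMap := fun {k} r v =>
    match k, r, v with
    | 1, _, v => Convex ℝ (v 0).1
    | 2, _, v => (v 0).1 ⊆ (v 1).1
    | 0, r, _ => r.elim
    | (_ + 3), r, _ => r.elim

/-- An affine transformation of ℝ^n: x ↦ Ax + b with A an invertible n×n real matrix. -/
def IsAffineEquiv (n : ℕ) (f : (Fin n → ℝ) → (Fin n → ℝ)) : Prop :=
  ∃ (A : Matrix (Fin n) (Fin n) ℝ) (b : Fin n → ℝ),
    IsUnit A.det ∧ ∀ x, f x = A.mulVec x + b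

namespace ACF

abbrev E := Fin 3 → ℝ
abbrev M := ROQel 3

/-! ### First-order definable predicates -/

/-- `P` is expressed by a first-order formula. -/
def D {α : Type} (P : (α → M) → Prop) : Prop :=
  ∃ φ : Lconv.Formula α, ∀ v : α → M, φ.Realize v ↔ P v

def relLe : Lconv.Relations 2 := (() : Unit)

def relConv : Lconv.Relations 1 := (() : Unit)

def le (a b : M) : Prop := a.1 ⊆ b.1

theorem D.le {α : Type} (i j : α) : D (fun v => le (v i) (v j)) := by
  refine ⟨FirstOrder.Language.Relations.formula₂ relLe
    (FirstOrder.Language.Term.var i) (FirstOrder.Language.Term.var j), fun v => ?_⟩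
  rw [FirstOrder.Language.Formula.realize_rel₂]
  rfl

theorem D.conv {α : Type} (i : α) : D (fun v => Convex ℝ (v i).1) := by
  refine ⟨FirstOrder.Language.Relations.formula₁ relConv
    (FirstOrder.Language.Term.var i), fun v => ?_⟩
  rw [FirstOrder.Language.Formula.realize_rel₁]
  rfl

theorem D.not {α : Type} {P : (α → M) → Prop} (hP : D P) : D (fun v => ¬ P v) := by
  obtain ⟨φ, h⟩ := hP
  exact ⟨φ.not, fun v => by rw [FirstOrder.Language.Formula.realize_not, h]⟩

theorem D.and {α : Type} {P Q : (α → M) → Prop} (hP : D P) (hQ : D Q) :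
    D (fun v => P v ∧ Q v) := by
  obtain ⟨φ, h⟩ := hP
  obtain ⟨ψ, h'⟩ := hQ
  exact ⟨φ ⊓ ψ, fun v => by rw [FirstOrder.Language.Formula.realize_inf, h, h']⟩

theorem D.or {α : Type} {P Q : (α → M) → Prop} (hP : D P) (hQ : D Q) :
    D (fun v => P v ∨ Q v) := by
  obtain ⟨φ, h⟩ := hP
  obtain ⟨ψ, h'⟩ := hQ
  exact ⟨φ ⊔ ψ, fun v => by rw [FirstOrder.Language.Formula.realize_sup, h, h']⟩

theorem D.imp {α : Type} {P Q : (α → M) → Prop} (hP : D P) (hQ : D Q) :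
    D (fun v => P v → Q v) := by
  obtain ⟨φ, h⟩ := hP
  obtain ⟨ψ, h'⟩ := hQ
  exact ⟨φ.imp ψ, fun v => by rw [FirstOrder.Language.Formula.realize_imp, h, h']⟩

theorem D.iff {α : Type} {P Q : (α → M) → Prop} (hP : D P) (hQ : D Q) :
    D (fun v => P v ↔ Q v) := by
  obtain ⟨φ, h⟩ := hP
  obtain ⟨ψ, h'⟩ := hQ
  exact ⟨φ.iff ψ, fun v => by rw [FirstOrder.Language.Formula.realize_iff, h, h']⟩

theorem D.fin {α β : Type} [Finite β] {P : β → (α → M) → Prop} (hP : ∀ b, D (P b)) :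
    D (fun v => ∀ b, P b v) := by
  choose φ h using hP
  exact ⟨FirstOrder.Language.Formula.iInf φ, fun v => by
    rw [FirstOrder.Language.Formula.realize_iInf]; exact forall_congr' fun b => h b v⟩

theorem D.exs {α β : Type} [Finite β] {P : (α → M) → (β → M) → Prop}
    (hP : D (fun w : α ⊕ β → M => P (fun i => w (Sum.inl i)) (fun i => w (Sum.inr i)))) :
    D (fun v => ∃ b, P v b) := by
  obtain ⟨φ, h⟩ := hP
  exact ⟨φ.iExs β, fun v => by
    rw [FirstOrder.Language.Formula.realize_iExs]; exact exists_congr fun b => h _⟩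

theorem D.ex {α : Type} {P : (α → M) → M → Prop}
    (hP : D (fun w : α ⊕ Unit → M => P (fun i => w (Sum.inl i)) (w (Sum.inr ())))) :
    D (fun v => ∃ b, P v b) := by
  obtain ⟨φ, h⟩ := D.exs (P := fun v (b : Unit → M) => P v (b ())) hP
  exact ⟨φ, fun v => (h v).trans ⟨fun ⟨b, hb⟩ => ⟨b (), hb⟩, fun ⟨b, hb⟩ => ⟨fun _ => b, hb⟩⟩⟩

theorem D.all {α : Type} {P : (α → M) → M → Prop}
    (hP : D (fun w : α ⊕ Unit → M => P (fun i => w (Sum.inl i)) (w (Sum.inr ())))) :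
    D (fun v => ∀ b, P v b) := by
  obtain ⟨φ, h⟩ := (D.ex (P := fun v b => ¬ P v b) hP.not).not
  exact ⟨φ, fun v => (h v).trans not_exists_not⟩

/-! ### Basic definable relations -/

def IsBot (d : M) : Prop := ∀ e, le d e

def Disj (a b : M) : Prop := ∀ d, le d a → le d b → IsBot d

def Btw (u v g : M) : Prop :=
  (∀ d, le d u → le d v → le d g) ∧ (∀ d, le u d → le v d → le g d)

def Hf (g : M) : Prop :=
  Convex ℝ g.1 ∧ ¬ IsBot g ∧ ∃ g' : M, Convex ℝ g'.1 ∧ ¬ IsBot g' ∧ Disj g g' ∧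
    ∀ d, le g d → le g' d → ∀ e, le e d

theorem D.isBot {α : Type} (i : α) : D (fun v => IsBot (v i)) := by
  unfold IsBot
  exact D.all (D.le (Sum.inl i) _)

theorem D.disj {α : Type} (i j : α) : D (fun v => Disj (v i) (v j)) := by
  unfold Disj
  exact D.all (D.imp (D.le _ (Sum.inl i)) (D.imp (D.le _ (Sum.inl j)) (D.isBot _)))

theorem D.btw {α : Type} (i j k : α) : D (fun v => Btw (v i) (v j) (v k)) := by
  unfold Btw
  exact D.and
    (D.all (D.imp (D.le _ (Sum.inl i)) (D.imp (D.le _ (Sum.inl j)) (D.le _ (Sum.inl k)))))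
    (D.all (D.imp (D.le (Sum.inl i) _) (D.imp (D.le (Sum.inl j) _) (D.le (Sum.inl k) _))))

theorem D.hf {α : Type} (i : α) : D (fun v => Hf (v i)) := by
  unfold Hf
  refine D.and (D.conv i) (D.and (D.not (D.isBot i)) (D.ex (D.and (D.conv _)
    (D.and (D.not (D.isBot _)) (D.and (D.disj (Sum.inl i) _) (D.all
      (D.imp (D.le (Sum.inl (Sum.inl i)) _) (D.imp (D.le (Sum.inl (Sum.inr ())) _)
        (D.all (D.le _ (Sum.inl (Sum.inr ()))))))))))))

/-! ### Regular open sets and half-spaces -/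

def HS (c : E) (d : ℝ) : Set E := {x | c ⬝ᵥ x < d}

theorem dot_cont (c : E) : Continuous (fun x : E => c ⬝ᵥ x) := by
  unfold dotProduct
  fun_prop

theorem dot_self_pos {c : E} (hc : c ≠ 0) : 0 < c ⬝ᵥ c := by
  have h0 : 0 ≤ c ⬝ᵥ c := Finset.sum_nonneg fun i _ => mul_self_nonneg (c i)
  exact lt_of_le_of_ne h0 fun h => hc (dotProduct_self_eq_zero.1 h.symm)

theorem dot_open {c : E} (hc : c ≠ 0) : IsOpenMap (fun x : E => c ⬝ᵥ x) := by
  let L : E →L[ℝ] ℝ := LinearMap.toContinuousLinearMap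
    { toFun := fun x => c ⬝ᵥ x
      map_add' := fun x y => dotProduct_add c x y
      map_smul' := fun t x => by simp [dotProduct_smul] }
  have hL : L ≠ 0 := by
    intro h
    have : L c = 0 := by rw [h]; rfl
    have h2 : c ⬝ᵥ c = 0 := this
    exact hc (dotProduct_self_eq_zero.1 h2)
  exact L.isOpenMap_of_ne_zero hL

theorem HS_open (c : E) (d : ℝ) : IsOpen (HS c d) := isOpen_lt (dot_cont c) continuous_const

theorem HS_closure {c : E} (hc : c ≠ 0) (d : ℝ) : closure (HS c d) = {x | c ⬝ᵥ x ≤ d} := by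
  have := (dot_open hc).preimage_closure_eq_closure_preimage (dot_cont c) (Set.Iio d)
  rw [closure_Iio] at this
  exact this.symm

theorem HS_reg {c : E} (hc : c ≠ 0) (d : ℝ) : interior (closure (HS c d)) = HS c d := by
  rw [HS_closure hc]
  have := (dot_open hc).preimage_interior_eq_interior_preimage (dot_cont c) (Set.Iic d)
  rw [interior_Iic] at this
  exact this.symm

theorem HS_compl {c : E} (hc : c ≠ 0) (d : ℝ) : interior (HS c d)ᶜ = HS (-c) (-d) := by
  rw [interior_compl, HS_closure hc]
  ext x
  simp [HS]

theorem HS_convex (c : E) (d : ℝ) : Convex ℝ (HS c d) :=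
  convex_halfSpace_lt (f := fun x => c ⬝ᵥ x)
    ⟨fun x y => dotProduct_add c x y, fun t x => by simp [dotProduct_smul]⟩ d

theorem HS_smul (c : E) (d : ℝ) {t : ℝ} (ht : 0 < t) : HS (t • c) (t * d) = HS c d := by
  ext x
  simp only [HS, Set.mem_ofPred_eq, smul_dotProduct, smul_eq_mul]
  exact mul_lt_mul_iff_right₀ ht

theorem HS_point {c : E} (hc : c ≠ 0) (s : ℝ) : ∃ x : E, c ⬝ᵥ x = s := by
  refine ⟨(s / (c ⬝ᵥ c)) • c, ?_⟩
  have := (dot_self_pos hc).ne'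
  simp only [dotProduct_smul, smul_eq_mul]
  field_simp

theorem HS_nonempty {c : E} (hc : c ≠ 0) (d : ℝ) : (HS c d).Nonempty := by
  obtain ⟨x, hx⟩ := HS_point hc (d - 1)
  exact ⟨x, by simp [HS, hx]⟩

theorem reg_inter {s t : Set E} (hs : interior (closure s) = s) (ht : interior (closure t) = t) :
    interior (closure (s ∩ t)) = s ∩ t := by
  apply Set.Subset.antisymm
  · refine Set.subset_inter ?_ ?_
    · conv_rhs => rw [← hs]
      exact interior_mono (closure_mono Set.inter_subset_left)
    · conv_rhs => rw [← ht]
      exact interior_mono (closure_mono Set.inter_subset_right)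
  · have ho : IsOpen (s ∩ t) := by
      rw [← hs, ← ht]; exact isOpen_interior.inter isOpen_interior
    exact interior_maximal subset_closure ho

theorem reg_int_closed {s : Set E} (hs : IsClosed s) :
    interior (closure (interior s)) = interior s := by
  apply Set.Subset.antisymm
  · apply interior_mono
    exact closure_minimal interior_subset hs
  · exact interior_maximal subset_closure isOpen_interior

theorem castne {c : Fin 3 → ℚ} (hc : c ≠ 0) : (fun i => (c i : ℝ)) ≠ (0 : E) := by
  intro h
  apply hc
  ext i
  have := congrFun h i
  simpa using this

theorem reg_of_roq {s : Set E} (h : InROQ 3 s) : interior (closure s) = s := by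
  induction h with
  | bot => simp
  | top => simp
  | halfspace s h =>
    obtain ⟨c, d, hc, rfl⟩ := h
    exact HS_reg (castne hc) d
  | inf s t _ _ hs ht => exact reg_inter hs ht
  | sup s t _ _ _ _ => exact reg_int_closed isClosed_closure
  | compl s hs ih =>
    have ho : IsOpen s := by rw [← ih]; exact isOpen_interior
    exact reg_int_closed ho.isClosed_compl

theorem open_of_roq {s : Set E} (h : InROQ 3 s) : IsOpen s := by
  rw [← reg_of_roq h]; exact isOpen_interior

theorem isBot_iff (d : M) : IsBot d ↔ d.1 = ∅ := by
  constructor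
  · intro h
    exact Set.subset_empty_iff.1 (h ⟨∅, InROQ.bot⟩)
  · intro h e x hx
    rw [h] at hx
    exact hx.elim

theorem disj_iff (a b : M) : Disj a b ↔ a.1 ∩ b.1 = ∅ := by
  constructor
  · intro h
    have := h ⟨a.1 ∩ b.1, InROQ.inf _ _ a.2 b.2⟩ Set.inter_subset_left Set.inter_subset_right
    exact (isBot_iff _).1 this
  · intro h d h1 h2
    rw [isBot_iff, ← Set.subset_empty_iff, ← h]
    exact Set.subset_inter h1 h2

theorem btw_sound {u v g : M} (h : Btw u v g) :
    u.1 ∩ v.1 ⊆ g.1 ∧ g.1 ⊆ closure (u.1 ∪ v.1) := by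
  refine ⟨h.1 ⟨u.1 ∩ v.1, InROQ.inf _ _ u.2 v.2⟩ Set.inter_subset_left Set.inter_subset_right, ?_⟩
  have ho : IsOpen (u.1 ∪ v.1) := (open_of_roq u.2).union (open_of_roq v.2)
  have hs : u.1 ∪ v.1 ⊆ interior (closure (u.1 ∪ v.1)) := interior_maximal subset_closure ho
  have h2 := h.2 ⟨_, InROQ.sup _ _ u.2 v.2⟩ (Set.subset_union_left.trans hs)
    (Set.subset_union_right.trans hs)
  exact (show g.1 ⊆ interior (closure (u.1 ∪ v.1)) from h2).trans interior_subset

theorem btw_complete {u v g : M} (h1 : u.1 ∩ v.1 ⊆ g.1) (h2 : g.1 ⊆ u.1 ∪ v.1) : Btw u v g :=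
  ⟨fun _ hu hv => (Set.subset_inter hu hv).trans h1, fun _ hu hv => h2.trans (Set.union_subset hu hv)⟩

theorem hf_sound {g : M} (h : Hf g) : ∃ (c : E) (d : ℝ), c ≠ 0 ∧ g.1 = HS c d := by
  obtain ⟨hc, hne, g', hc', hne', hd, htop⟩ := h
  rw [isBot_iff, ← Ne, ← Set.nonempty_iff_ne_empty] at hne hne'
  rw [disj_iff] at hd
  have ho := open_of_roq g.2
  have ho' := open_of_roq g'.2
  obtain ⟨f, u, hf, hf'⟩ := geometric_hahn_banach_open_open hc ho hc' ho'
    (Set.disjoint_iff_inter_eq_empty.2 hd)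
  let c : E := fun i => f (Pi.single i 1)
  have hfc : ∀ x, f x = c ⬝ᵥ x := by
    intro x
    conv_lhs => rw [pi_eq_sum_univ' x]
    simp [c, dotProduct, map_sum, mul_comm]
  refine ⟨c, u, ?_, ?_⟩
  · rintro hc0
    obtain ⟨x, hx⟩ := hne
    obtain ⟨y, hy⟩ := hne'
    have h1 := hf x hx
    have h2 := hf' y hy
    rw [hfc, hc0, zero_dotProduct] at h1 h2
    linarith
  · apply Set.Subset.antisymm
    · intro x hx
      have := hf x hx
      rw [hfc] at this
      exact this
    · have ho2 : IsOpen (g.1 ∪ g'.1) := ho.union ho'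
      have hs : g.1 ∪ g'.1 ⊆ interior (closure (g.1 ∪ g'.1)) := interior_maximal subset_closure ho2
      have huniv : Set.univ ⊆ interior (closure (g.1 ∪ g'.1)) :=
        htop ⟨_, InROQ.sup _ _ g.2 g'.2⟩ (Set.subset_union_left.trans hs)
          (Set.subset_union_right.trans hs) ⟨_, InROQ.top⟩
      have hcl : HS c u ⊆ closure g.1 := by
        intro x hx
        have hx2 : x ∈ closure (g.1 ∪ g'.1) := interior_subset (huniv (Set.mem_univ x))
        rw [closure_union] at hx2
        rcases hx2 with hx2 | hx2
        · exact hx2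
        · exfalso
          have hcl' : closure g'.1 ⊆ {y | u ≤ c ⬝ᵥ y} := by
            apply closure_minimal
            · intro y hy
              have := hf' y hy
              rw [hfc] at this
              exact this.le
            · exact isClosed_le continuous_const (dot_cont c)
          have h1 : u ≤ c ⬝ᵥ x := hcl' hx2
          have h2 : c ⬝ᵥ x < u := hx
          linarith
      rw [← reg_of_roq g.2]
      exact interior_maximal hcl (HS_open c u)

/-- The half-space with rational coefficients. -/
def Q (c : Fin 3 → ℚ) (d : ℚ) : Set E := HS (fun i => (c i : ℝ)) (d : ℝ)

theorem Q_roq {c : Fin 3 → ℚ} (hc : c ≠ 0) (d : ℚ) : InROQ 3 (Q c d) :=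
  InROQ.halfspace _ ⟨c, d, hc, rfl⟩

theorem Q_compl {c : Fin 3 → ℚ} (hc : c ≠ 0) (d : ℚ) : interior (Q c d)ᶜ = Q (-c) (-d) := by
  unfold Q
  rw [HS_compl (castne hc)]
  congr 1
  · ext i; simp
  · simp

theorem hf_complete {c : Fin 3 → ℚ} (hc : c ≠ 0) (d : ℚ) {g : M} (hg : g.1 = Q c d) : Hf g := by
  have hc' : -c ≠ 0 := neg_ne_zero.2 hc
  obtain ⟨g', hg'⟩ : ∃ g' : M, g'.1 = Q (-c) (-d) := ⟨⟨Q (-c) (-d), Q_roq hc' _⟩, rfl⟩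
  refine ⟨hg ▸ HS_convex _ _, ?_, g', hg' ▸ HS_convex _ _, ?_, ?_, ?_⟩
  · rw [isBot_iff, hg]; exact (HS_nonempty (castne hc) _).ne_empty
  · rw [isBot_iff, hg']; exact (HS_nonempty (castne hc') _).ne_empty
  · rw [disj_iff, hg, hg', ← Q_compl hc, ← Set.disjoint_iff_inter_eq_empty]
    exact Set.disjoint_of_subset_right interior_subset disjoint_compl_right
  · intro e h1 h2 e'
    have h1 : Q c d ⊆ e.1 := by rw [← hg]; exact h1
    have h2 : Q (-c) (-d) ⊆ e.1 := by rw [← hg']; exact h2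
    have : closure e.1 = Set.univ := by
      rw [Set.eq_univ_iff_forall]
      intro x
      rcases le_or_gt ((fun i => (c i : ℝ)) ⬝ᵥ x) d with h | h
      · apply closure_mono h1
        rw [Q, HS_closure (castne hc)]
        exact h
      · apply subset_closure
        apply h2
        rw [← Q_compl hc, Q, interior_compl, HS_closure (castne hc)]
        simpa using h
    have h3 := reg_of_roq e.2
    rw [this, interior_univ] at h3
    show e'.1 ⊆ e.1
    rw [← h3]
    exact Set.subset_univ _

/-! ### Uniqueness lemmas -/

theorem HS_sub {c c' : E} {d d' : ℝ} (hc : c ≠ 0) (hc' : c' ≠ 0) (h : HS c d ⊆ HS c' d') :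
    ∃ t : ℝ, 0 < t ∧ c' = t • c ∧ t * d ≤ d' := by
  have key : ∀ x, c ⬝ᵥ x < d → c' ⬝ᵥ x < d' := fun x hx => h hx
  have hcc := dot_self_pos hc
  obtain ⟨e, he⟩ := HS_point hc 1
  have hk : ∀ k, c ⬝ᵥ k = 0 → c' ⬝ᵥ k = 0 := by
    intro k hk
    by_contra hne
    obtain ⟨p, hp⟩ := HS_nonempty hc d
    have hp : c ⬝ᵥ p < d := hp
    have := key (p + ((d' - c' ⬝ᵥ p) / (c' ⬝ᵥ k)) • k) (by
      simp [dotProduct_add, dotProduct_smul, hk, hp])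
    simp only [dotProduct_add, dotProduct_smul, smul_eq_mul] at this
    rw [div_mul_cancel₀ _ hne] at this
    linarith
  have hct : c' = (c' ⬝ᵥ e) • c := by
    apply dotProduct_eq
    intro x
    have := hk (x - (c ⬝ᵥ x) • e) (by simp [dotProduct_sub, dotProduct_smul, he])
    simp only [dotProduct_sub, dotProduct_smul, smul_eq_mul] at this
    simp only [smul_dotProduct, smul_eq_mul]
    linarith
  have ht0 : c' ⬝ᵥ e ≠ 0 := by
    intro h0
    rw [h0, zero_smul] at hct
    exact hc' hct
  generalize c' ⬝ᵥ e = t at *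
  have key2 : ∀ s, s < d → t * s < d' := by
    intro s hs
    have := key (s • e) (by simp [dotProduct_smul, he, hs])
    rw [hct] at this
    simpa [dotProduct_smul, smul_dotProduct, he, mul_comm] using this
  have htpos : 0 < t := by
    by_contra hneg
    have hneg : t < 0 := lt_of_le_of_ne (not_lt.1 hneg) ht0
    rcases lt_or_ge (d' / t) d with h1 | h1
    · have := key2 _ h1
      rw [mul_div_cancel₀ _ ht0] at this
      exact lt_irrefl _ this
    · have := key2 (d - 1) (by linarith)
      have h2 := mul_le_mul_of_nonpos_left h1 hneg.le
      rw [mul_div_cancel₀ _ ht0] at h2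
      linarith
  refine ⟨t, htpos, hct, ?_⟩
  by_contra hlt
  have := key2 (d' / t) (by rw [div_lt_iff₀' htpos]; linarith)
  rw [mul_div_cancel₀ _ ht0] at this
  exact lt_irrefl _ this

/-- `e₁, e₂` is dual to `a, b`. -/
def Dual (a b e₁ e₂ : E) : Prop :=
  a ⬝ᵥ e₁ = 1 ∧ a ⬝ᵥ e₂ = 0 ∧ b ⬝ᵥ e₁ = 0 ∧ b ⬝ᵥ e₂ = 1

theorem cone {c₁ c₂ e₁ e₂ c : E} {d₁ d₂ d : ℝ} (hI : Dual c₁ c₂ e₁ e₂)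
    (h1 : HS c₁ d₁ ∩ HS c₂ d₂ ⊆ HS c d) (h2 : HS c d ⊆ closure (HS c₁ d₁ ∪ HS c₂ d₂)) :
    ∃ s t : ℝ, 0 ≤ s ∧ 0 ≤ t ∧ c = s • c₁ + t • c₂ ∧ d = s * d₁ + t * d₂ := by
  obtain ⟨h11, h12, h21, h22⟩ := hI
  have hc₁ : c₁ ≠ 0 := by rintro rfl; simp at h11
  have hc₂ : c₂ ≠ 0 := by rintro rfl; simp at h22
  have k1 : ∀ x, c₁ ⬝ᵥ x < d₁ → c₂ ⬝ᵥ x < d₂ → c ⬝ᵥ x < d := fun x hx hy => h1 ⟨hx, hy⟩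
  have k2 : ∀ x, d₁ < c₁ ⬝ᵥ x → d₂ < c₂ ⬝ᵥ x → d ≤ c ⬝ᵥ x := by
    intro x hx hy
    by_contra hlt
    have := h2 (show x ∈ HS c d from not_le.1 hlt)
    rw [closure_union, HS_closure hc₁, HS_closure hc₂] at this
    rcases this with h | h
    · exact absurd hx (not_lt.2 h)
    · exact absurd hy (not_lt.2 h)
  have hk : ∀ k, c₁ ⬝ᵥ k = 0 → c₂ ⬝ᵥ k = 0 → c ⬝ᵥ k = 0 := by
    intro k hk1 hk2
    by_contra hne
    let p : E := (d₁ - 1) • e₁ + (d₂ - 1) • e₂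
    have := k1 (p + ((d - c ⬝ᵥ p) / (c ⬝ᵥ k)) • k)
      (by simp [p, dotProduct_add, dotProduct_smul, hk1, h11, h12])
      (by simp [p, dotProduct_add, dotProduct_smul, hk2, h21, h22])
    rw [dotProduct_add, dotProduct_smul, smul_eq_mul, div_mul_cancel₀ _ hne] at this
    linarith
  have hc : c = (c ⬝ᵥ e₁) • c₁ + (c ⬝ᵥ e₂) • c₂ := by
    apply dotProduct_eq
    intro x
    have := hk (x - ((c₁ ⬝ᵥ x) • e₁ + (c₂ ⬝ᵥ x) • e₂))
      (by simp [dotProduct_sub, dotProduct_add, dotProduct_smul, h11, h12])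
      (by simp [dotProduct_sub, dotProduct_add, dotProduct_smul, h21, h22])
    simp only [dotProduct_sub, dotProduct_add, dotProduct_smul, smul_eq_mul] at this
    simp only [add_dotProduct, smul_dotProduct, smul_eq_mul]
    linarith
  generalize c ⬝ᵥ e₁ = s at *
  generalize c ⬝ᵥ e₂ = t at *
  have m1 : ∀ x y, x < 0 → y < 0 → s * (d₁ + x) + t * (d₂ + y) < d := by
    intro x y hx hy
    have := k1 ((d₁ + x) • e₁ + (d₂ + y) • e₂)
      (by simp [dotProduct_add, dotProduct_smul, h11, h12, hx])
      (by simp [dotProduct_add, dotProduct_smul, h21, h22, hy])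
    rw [hc] at this
    simp only [add_dotProduct, smul_dotProduct, dotProduct_add, dotProduct_smul, h11, h12, h21,
      h22, smul_eq_mul] at this
    linarith
  have m2 : ∀ x y, 0 < x → 0 < y → d ≤ s * (d₁ + x) + t * (d₂ + y) := by
    intro x y hx hy
    have := k2 ((d₁ + x) • e₁ + (d₂ + y) • e₂)
      (by simp [dotProduct_add, dotProduct_smul, h11, h12, hx])
      (by simp [dotProduct_add, dotProduct_smul, h21, h22, hy])
    rw [hc] at this
    simp only [add_dotProduct, smul_dotProduct, dotProduct_add, dotProduct_smul, h11, h12, h21,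
      h22, smul_eq_mul] at this
    linarith
  have hs : 0 ≤ s := by
    by_contra hs
    have hs := not_le.1 hs
    have a1 := m1 (-1) (-1) (by norm_num) (by norm_num)
    have := m2 (1 + (|t| + |t|) / (-s)) 1 (by
      have := abs_nonneg t
      have : 0 ≤ (|t| + |t|) / (-s) := div_nonneg (by linarith) (by linarith)
      linarith) one_pos
    have e : s * ((|t| + |t|) / (-s)) = - (|t| + |t|) := by
      have := hs.ne
      field_simp
    have := le_abs_self t
    nlinarith
  have ht : 0 ≤ t := by
    by_contra ht
    have ht := not_le.1 ht
    have a1 := m1 (-1) (-1) (by norm_num) (by norm_num)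
    have := m2 1 (1 + (|s| + |s|) / (-t)) one_pos (by
      have := abs_nonneg s
      have : 0 ≤ (|s| + |s|) / (-t) := div_nonneg (by linarith) (by linarith)
      linarith)
    have e : t * ((|s| + |s|) / (-t)) = - (|s| + |s|) := by
      have := ht.ne
      field_simp
    have := le_abs_self s
    nlinarith
  refine ⟨s, t, hs, ht, hc, ?_⟩
  apply le_antisymm
  · apply le_of_forall_pos_le_add
    intro ε hε
    have hst : 0 < s + t + 1 := by linarith
    have hpos : 0 < ε / (s + t + 1) := div_pos hε hst
    have := m2 _ _ hpos hpos
    have e : ε / (s + t + 1) * (s + t + 1) = ε := div_mul_cancel₀ _ hst.ne'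
    nlinarith
  · apply le_of_forall_pos_le_add
    intro ε hε
    have hst : 0 < s + t + 1 := by linarith
    have hpos : 0 < ε / (s + t + 1) := div_pos hε hst
    have := m1 (-(ε / (s + t + 1))) (-(ε / (s + t + 1))) (by linarith) (by linarith)
    have e : ε / (s + t + 1) * (s + t + 1) = ε := div_mul_cancel₀ _ hst.ne'
    nlinarith

theorem HS_scaled {c₁ c₂ c : E} {d₁ d₂ d s : ℝ} (hc0 : c ≠ 0) (hs : 0 ≤ s)
    (hc : c = s • c₁ + s • c₂) (hd : d = s * d₁ + s * d₂) : HS c d = HS (c₁ + c₂) (d₁ + d₂) := by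
  have : 0 < s := by
    refine lt_of_le_of_ne hs ?_
    rintro rfl
    simp at hc
    exact hc0 hc
  rw [hc, hd, ← smul_add, ← mul_add, HS_smul _ _ this]

theorem uniqA {c₁ c₂ e₁ e₂ c : E} {d₁ d₂ d w : ℝ} (hI : Dual c₁ c₂ e₁ e₂) (hc0 : c ≠ 0)
    (h1 : HS c₁ d₁ ∩ HS c₂ d₂ ⊆ HS c d) (h2 : HS c d ⊆ closure (HS c₁ d₁ ∪ HS c₂ d₂))
    (h3 : HS c d ⊆ HS (c₁ + c₂) w ∨ HS (c₁ + c₂) w ⊆ HS c d) :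
    HS c d = HS (c₁ + c₂) (d₁ + d₂) := by
  obtain ⟨s, t, hs, ht, hc, hd⟩ := cone hI h1 h2
  obtain ⟨h11, h12, h21, h22⟩ := hI
  have hne : c₁ + c₂ ≠ 0 := by
    intro h
    have := congrArg (fun v => v ⬝ᵥ e₁) h
    simp [add_dotProduct, h11, h21] at this
  have es : c ⬝ᵥ e₁ = s := by rw [hc]; simp [add_dotProduct, smul_dotProduct, h11, h21]
  have et : c ⬝ᵥ e₂ = t := by rw [hc]; simp [add_dotProduct, smul_dotProduct, h12, h22]
  have e1 : (c₁ + c₂) ⬝ᵥ e₁ = 1 := by simp [add_dotProduct, h11, h21]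
  have e2 : (c₁ + c₂) ⬝ᵥ e₂ = 1 := by simp [add_dotProduct, h12, h22]
  have hst : s = t := by
    rcases h3 with h3 | h3
    · obtain ⟨r, hr, h, -⟩ := HS_sub hc0 hne h3
      rw [h, smul_dotProduct, es, smul_eq_mul] at e1
      rw [h, smul_dotProduct, et, smul_eq_mul] at e2
      exact mul_left_cancel₀ hr.ne' (e1.trans e2.symm)
    · obtain ⟨r, hr, h, -⟩ := HS_sub hne hc0 h3
      rw [h, smul_dotProduct, e1] at es
      rw [h, smul_dotProduct, e2] at et
      exact es.symm.trans et
  subst hst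
  exact HS_scaled hc0 hs hc hd

theorem uniqB {c₁ c₂ e₁ e₂ c : E} {d : ℝ} (hI : Dual c₁ c₂ e₁ e₂) (hc0 : c ≠ 0)
    (h1 : HS c₁ 1 ∩ HS c₂ 0 ⊆ HS c d) (h2 : HS c d ⊆ closure (HS c₁ 1 ∪ HS c₂ 0))
    (h3 : HS c₁ 0 ∩ HS c₂ 1 ⊆ HS c d) (h4 : HS c d ⊆ closure (HS c₁ 0 ∪ HS c₂ 1)) :
    HS c d = HS (c₁ + c₂) 1 := by
  obtain ⟨s, t, hs, ht, hc, hd⟩ := cone hI h1 h2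
  obtain ⟨s', t', hs', ht', hc', hd'⟩ := cone hI h3 h4
  obtain ⟨h11, h12, h21, h22⟩ := hI
  have es : c ⬝ᵥ e₁ = s := by rw [hc]; simp [add_dotProduct, smul_dotProduct, h11, h21]
  have et : c ⬝ᵥ e₂ = t := by rw [hc]; simp [add_dotProduct, smul_dotProduct, h12, h22]
  have et' : c ⬝ᵥ e₂ = t' := by rw [hc']; simp [add_dotProduct, smul_dotProduct, h12, h22]
  have hst : s = t := by linarith
  subst hst
  have := HS_scaled hc0 hs hc hd
  simpa using this

theorem exists_dual {a b : E} (h : crossProduct a b ≠ 0) : ∃ e₁ e₂, Dual a b e₁ e₂ := by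
  let n : E := crossProduct a b
  have hn : 0 < n ⬝ᵥ n := dot_self_pos h
  refine ⟨(n ⬝ᵥ n)⁻¹ • (crossProduct b n), (n ⬝ᵥ n)⁻¹ • (crossProduct n a), ?_, ?_, ?_, ?_⟩ <;>
    rw [dotProduct_smul, smul_eq_mul]
  · have : a ⬝ᵥ (crossProduct b n) = n ⬝ᵥ n := by
      simp [n, cross_apply, dotProduct, Fin.sum_univ_three]; ring
    rw [this, inv_mul_cancel₀ hn.ne']
  · rw [dot_cross_self, mul_zero]
  · rw [dot_self_cross, mul_zero]
  · have : b ⬝ᵥ (crossProduct n a) = n ⬝ᵥ n := by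
      simp [n, cross_apply, dotProduct, Fin.sum_univ_three]; ring
    rw [this, inv_mul_cancel₀ hn.ne']

/-! ### Pulling back along affine equivalences -/

abbrev Aff := E ≃ᵃ[ℝ] E

theorem aff_closure (τ : Aff) (s : Set E) : τ '' closure s = closure (τ '' s) :=
  (AffineEquiv.toContinuousAffineEquiv τ).toHomeomorph.image_closure s

theorem aff_interior (τ : Aff) (s : Set E) : τ '' interior s = interior (τ '' s) :=
  (AffineEquiv.toContinuousAffineEquiv τ).toHomeomorph.image_interior s

theorem aff_compl (τ : Aff) (s : Set E) : τ '' sᶜ = (τ '' s)ᶜ :=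
  Set.image_compl_eq τ.bijective

theorem aff_inter (τ : Aff) (s t : Set E) : τ '' (s ∩ t) = τ '' s ∩ τ '' t :=
  Set.image_inter τ.injective

theorem eq_image (τ : Aff) {g r : Set E} (h : τ ⁻¹' g = r) : g = τ '' r := by
  rw [← h, Set.image_preimage_eq _ τ.surjective]

theorem pull_sub_left (τ : Aff) {g r : Set E} (h : g ⊆ τ '' r) : τ ⁻¹' g ⊆ r := by
  intro x hx
  obtain ⟨y, hy, hxy⟩ := h hx
  rwa [← τ.injective hxy]

theorem pull_sub_right (τ : Aff) {g r : Set E} (h : τ '' r ⊆ g) : r ⊆ τ ⁻¹' g :=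
  Set.image_subset_iff.1 h

theorem pull_btw (τ : Aff) {u v g : M} {a b : Set E} (h : Btw u v g) (hu : u.1 = τ '' a)
    (hv : v.1 = τ '' b) : a ∩ b ⊆ τ ⁻¹' g.1 ∧ τ ⁻¹' g.1 ⊆ closure (a ∪ b) := by
  have := btw_sound h
  rw [hu, hv, ← aff_inter, ← Set.image_union, ← aff_closure] at this
  exact ⟨pull_sub_right τ this.1, pull_sub_left τ this.2⟩

theorem pull_HS (τ : Aff) {c : E} (hc : c ≠ 0) (d : ℝ) :
    ∃ (c' : E) (d' : ℝ), c' ≠ 0 ∧ τ ⁻¹' (HS c d) = HS c' d' := by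
  have key : ∀ x, c ⬝ᵥ τ x = (fun i => c ⬝ᵥ τ.linear (Pi.single i 1)) ⬝ᵥ x + c ⬝ᵥ τ 0 := by
    intro x
    have h1 : τ x = τ.linear x + τ 0 := by
      have := τ.map_vadd 0 x
      simpa using this
    rw [h1, dotProduct_add]
    congr 1
    conv_lhs => rw [pi_eq_sum_univ' x]
    simp only [map_sum, map_smul, dotProduct_sum, dotProduct_smul]
    simp [dotProduct, mul_comm]
  refine ⟨fun i => c ⬝ᵥ τ.linear (Pi.single i 1), d - c ⬝ᵥ τ 0, ?_, ?_⟩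
  · intro h0
    obtain ⟨x, hx⟩ := HS_point hc (c ⬝ᵥ τ 0 + 1)
    have := key (τ.symm x)
    rw [h0, zero_dotProduct, AffineEquiv.apply_symm_apply, hx] at this
    linarith
  · ext x
    have : x ∈ τ ⁻¹' (HS c d) ↔ c ⬝ᵥ τ x < d := Iff.rfl
    rw [this, key]
    exact lt_sub_iff_add_lt.symm

/-! ### Regions determined by the frame -/

abbrev Idx := Fin 3 × Bool

abbrev ev (i : Fin 3) : Fin 3 → ℚ := Pi.single i 1

theorem ev_ne (i : Fin 3) : ev i ≠ 0 := by simp [ev]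

/-- The standard frame: `x_i < 0` and `x_i < 1`. -/
def F0 (p : Idx) : M := ⟨Q (ev p.1) (if p.2 then 1 else 0), Q_roq (ev_ne _) _⟩

/-- `r` is determined, by a first-order formula, from the frame, equivariantly. -/
def Good (r : Set E) : Prop :=
  ∃ S : (Idx → M) → M → Prop,
    (∀ (α : Type) (f : Idx → α) (j : α), D (fun v : α → M => S (fun i => v (f i)) (v j))) ∧
    (∃ g : M, g.1 = r ∧ S F0 g) ∧
    ∀ (τ : Aff) (F : Idx → M) (g : M), (∀ i, (F i).1 = τ '' (F0 i).1) → S F g → g.1 = τ '' r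

theorem good_of_rel {k : ℕ} (a : Fin k → Set E) (ha : ∀ i, Good (a i))
    (R : (Fin k → M) → M → Prop)
    (hR : ∀ (α : Type) (f : Fin k → α) (j : α), D (fun v : α → M => R (fun i => v (f i)) (v j)))
    (r : Set E) (hr : InROQ 3 r)
    (hex : ∀ (b : Fin k → M) (g : M), (∀ i, (b i).1 = a i) → g.1 = r → R b g)
    (huniq : ∀ (τ : Aff) (b : Fin k → M) (g : M), (∀ i, (b i).1 = τ '' a i) → R b g →
      g.1 = τ '' r) : Good r := by
  choose S hD hS0 hS using ha
  choose b0 hb0 hSb0 using hS0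
  refine ⟨fun F g => ∃ b : Fin k → M, (∀ i, S i F (b i)) ∧ R b g, ?_, ?_, ?_⟩
  · intro α f j
    refine D.exs (D.and (D.fin fun i => ?_) ?_)
    · exact hD i _ (fun p => Sum.inl (f p)) (Sum.inr i)
    · exact hR _ (fun i => Sum.inr i) (Sum.inl j)
  · exact ⟨⟨r, hr⟩, rfl, b0, hSb0, hex b0 _ hb0 rfl⟩
  · rintro τ F g hF ⟨b, hb, hRb⟩
    exact huniq τ b g (fun i => hS i τ F (b i) hF (hb i)) hRb

theorem good_frame (p : Idx) : Good (F0 p).1 :=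
  ⟨fun F g => le (F p) g ∧ le g (F p),
    fun α f j => D.and (D.le (f p) j) (D.le j (f p)),
    ⟨F0 p, rfl, Set.Subset.rfl, Set.Subset.rfl⟩,
    fun τ F g hF h => by rw [← hF]; exact Set.Subset.antisymm h.2 h.1⟩

theorem good_roq {r : Set E} (h : Good r) : InROQ 3 r := by
  obtain ⟨S, -, ⟨g, rfl, -⟩, -⟩ := h
  exact g.2

theorem good_bot : Good ∅ := by
  refine good_of_rel (k := 0) (fun _ => ∅) (fun i => i.elim0) (fun _ g => IsBot g)
    (fun α f j => D.isBot j) ∅ InROQ.bot ?_ ?_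
  · intro b g _ hg
    exact (isBot_iff g).2 hg
  · intro τ b g _ h
    rw [(isBot_iff g).1 h, Set.image_empty]

theorem good_inf {s t : Set E} (hs : Good s) (ht : Good t) : Good (s ∩ t) := by
  refine good_of_rel (k := 2) ![s, t] (fun i => by fin_cases i <;> assumption)
    (fun b g => ∀ c, le c g ↔ (le c (b 0) ∧ le c (b 1)))
    (fun α f j => D.all (D.iff (D.le _ (Sum.inl j))
      (D.and (D.le _ (Sum.inl (f 0))) (D.le _ (Sum.inl (f 1))))))
    _ (InROQ.inf _ _ (good_roq hs) (good_roq ht)) ?_ ?_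
  · intro b g hb hg c
    have h0 : (b 0).1 = s := hb 0
    have h1 : (b 1).1 = t := hb 1
    unfold le
    rw [hg, h0, h1, Set.subset_inter_iff]
  · intro τ b g hb h
    have h0 : (b 0).1 = τ '' s := hb 0
    have h1 : (b 1).1 = τ '' t := hb 1
    rw [aff_inter, ← h0, ← h1]
    apply Set.Subset.antisymm
    · have := (h g).1 Set.Subset.rfl
      exact Set.subset_inter this.1 this.2
    · exact (h ⟨_, InROQ.inf _ _ (b 0).2 (b 1).2⟩).2
        ⟨Set.inter_subset_left, Set.inter_subset_right⟩

theorem sub_int_compl {c s : Set E} (hc : IsOpen c) : c ⊆ interior sᶜ ↔ c ∩ s = ∅ := by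
  rw [← Set.disjoint_iff_inter_eq_empty, ← Set.subset_compl_iff_disjoint_right]
  exact ⟨fun h => h.trans interior_subset, fun h => interior_maximal h hc⟩

theorem good_compl {s : Set E} (hs : Good s) : Good (interior sᶜ) := by
  refine good_of_rel (k := 1) (fun _ => s) (fun _ => hs)
    (fun b g => ∀ c, le c g ↔ Disj c (b 0))
    (fun α f j => D.all (D.iff (D.le _ (Sum.inl j)) (D.disj _ (Sum.inl (f 0)))))
    _ (InROQ.compl _ (good_roq hs)) ?_ ?_
  · intro b g hb hg c
    rw [disj_iff, hb 0]
    unfold le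
    rw [hg]
    exact sub_int_compl (open_of_roq c.2)
  · intro τ b g hb h
    rw [aff_interior, aff_compl, ← hb 0]
    apply Set.Subset.antisymm
    · rw [sub_int_compl (open_of_roq g.2), ← disj_iff]
      exact (h g).1 Set.Subset.rfl
    · refine (h ⟨_, InROQ.compl _ (b 0).2⟩).2 ((disj_iff _ _).2 ?_)
      exact (sub_int_compl isOpen_interior).1 Set.Subset.rfl

theorem good_sup {s t : Set E} (hs : Good s) (ht : Good t) :
    Good (interior (closure (s ∪ t))) := by
  have h := good_compl (good_inf (good_compl hs) (good_compl ht))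
  have e : (interior sᶜ ∩ interior tᶜ)ᶜ = closure (s ∪ t) := by
    rw [← interior_inter, ← Set.compl_union, interior_compl, compl_compl]
  rwa [e] at h

theorem good_top : Good Set.univ := by
  have := good_compl good_bot
  simpa using this

/-! ### Rational half-spaces are determined -/

def G (c : Fin 3 → ℚ) (d : ℚ) : Prop := Good (Q c d)

def Ind (a b : Fin 3 → ℚ) : Prop := crossProduct a b ≠ 0

theorem ind_dual {a b : Fin 3 → ℚ} (h : Ind a b) :
    ∃ e₁ e₂ : E, Dual (fun i => (a i : ℝ)) (fun i => (b i : ℝ)) e₁ e₂ := by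
  apply exists_dual
  intro h0
  apply castne h
  rw [← h0]
  ext i
  fin_cases i <;> simp [cross_apply]

theorem ind_add_ne {a b : Fin 3 → ℚ} (h : Ind a b) : a + b ≠ 0 := by
  intro h0
  apply h
  rw [eq_neg_of_add_eq_zero_left h0]
  simp

theorem mem_Q {c : Fin 3 → ℚ} {d : ℚ} {x : E} :
    x ∈ Q c d ↔ (fun i => (c i : ℝ)) ⬝ᵥ x < (d : ℝ) := Iff.rfl

theorem Q_add (c₁ c₂ : Fin 3 → ℚ) (d₁ d₂ : ℚ) :
    Q (c₁ + c₂) (d₁ + d₂) =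
      HS ((fun i => (c₁ i : ℝ)) + (fun i => (c₂ i : ℝ))) ((d₁ : ℝ) + d₂) := by
  unfold Q
  congr 1
  · ext i; simp
  · simp

theorem btw_add {c₁ c₂ : Fin 3 → ℚ} {d₁ d₂ : ℚ} {u v g : M} (hu : u.1 = Q c₁ d₁)
    (hv : v.1 = Q c₂ d₂) (hg : g.1 = Q (c₁ + c₂) (d₁ + d₂)) : Btw u v g := by
  rw [Q_add] at hg
  apply btw_complete
  · rw [hu, hv, hg]
    rintro x ⟨h1, h2⟩
    rw [mem_Q] at h1 h2
    simp only [HS, Set.mem_ofPred_eq, add_dotProduct]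
    linarith
  · rw [hu, hv, hg]
    intro x hx
    simp only [HS, Set.mem_ofPred_eq, add_dotProduct] at hx
    rcases lt_or_ge ((fun i => (c₁ i : ℝ)) ⬝ᵥ x) d₁ with h | h
    · exact Or.inl h
    · refine Or.inr (mem_Q.2 ?_)
      linarith

theorem G_A {c₁ c₂ : Fin 3 → ℚ} {d₁ d₂ w : ℚ} (hI : Ind c₁ c₂) (h1 : G c₁ d₁) (h2 : G c₂ d₂)
    (h3 : G (c₁ + c₂) w) : G (c₁ + c₂) (d₁ + d₂) := by
  refine good_of_rel (k := 3) ![Q c₁ d₁, Q c₂ d₂, Q (c₁ + c₂) w]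
    (fun i => by fin_cases i <;> assumption)
    (fun b g => Hf g ∧ Btw (b 0) (b 1) g ∧ (le g (b 2) ∨ le (b 2) g))
    (fun α f j => D.and (D.hf j) (D.and (D.btw (f 0) (f 1) j)
      (D.or (D.le j (f 2)) (D.le (f 2) j))))
    _ (Q_roq (ind_add_ne hI) _) ?_ ?_
  · intro b g hb hg
    refine ⟨hf_complete (ind_add_ne hI) _ hg, btw_add (hb 0) (hb 1) hg, ?_⟩
    unfold le
    have h2 : (b 2).1 = Q (c₁ + c₂) w := hb 2
    rw [hg, h2]
    rcases le_total (d₁ + d₂) w with h | h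
    · left
      intro x hx
      rw [mem_Q] at hx ⊢
      exact lt_of_lt_of_le hx (by exact_mod_cast h)
    · right
      intro x hx
      rw [mem_Q] at hx ⊢
      exact lt_of_lt_of_le hx (by exact_mod_cast h)
  · rintro τ b g hb ⟨hf, hbtw, hp⟩
    apply eq_image
    have b1 := pull_btw τ hbtw (hb 0) (hb 1)
    obtain ⟨c0, d0, hc0, hg0⟩ := hf_sound hf
    obtain ⟨c, d, hc, hg⟩ := pull_HS τ hc0 d0
    obtain ⟨e₁, e₂, hD⟩ := ind_dual hI
    have h2 : (b 2).1 = τ '' Q (c₁ + c₂) w := hb 2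
    have hp' : τ ⁻¹' g.1 ⊆ Q (c₁ + c₂) w ∨ Q (c₁ + c₂) w ⊆ τ ⁻¹' g.1 := by
      rcases hp with h | h
      · left; apply pull_sub_left; rw [← h2]; exact h
      · right; apply pull_sub_right; rw [← h2]; exact h
    rw [hg0, hg] at b1 hp'
    rw [hg0, hg, Q_add]
    have e := Q_add c₁ c₂ w 0
    rw [add_zero] at e
    rw [e] at hp'
    exact uniqA hD hc b1.1 b1.2 hp'

theorem G_B {c₁ c₂ : Fin 3 → ℚ} (hI : Ind c₁ c₂) (h1 : G c₁ 0) (h2 : G c₁ 1) (h3 : G c₂ 0)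
    (h4 : G c₂ 1) : G (c₁ + c₂) 1 := by
  refine good_of_rel (k := 4) ![Q c₁ 1, Q c₂ 0, Q c₁ 0, Q c₂ 1]
    (fun i => by fin_cases i <;> assumption)
    (fun b g => Hf g ∧ Btw (b 0) (b 1) g ∧ Btw (b 2) (b 3) g)
    (fun α f j => D.and (D.hf j) (D.and (D.btw (f 0) (f 1) j) (D.btw (f 2) (f 3) j)))
    _ (Q_roq (ind_add_ne hI) _) ?_ ?_
  · intro b g hb hg
    refine ⟨hf_complete (ind_add_ne hI) _ hg, btw_add (hb 0) (hb 1) ?_,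
      btw_add (hb 2) (hb 3) ?_⟩
    · rw [hg]; simp
    · rw [hg]; simp
  · rintro τ b g hb ⟨hf, hbtw, hbtw'⟩
    apply eq_image
    have b1 := pull_btw τ hbtw (hb 0) (hb 1)
    have b2 := pull_btw τ hbtw' (hb 2) (hb 3)
    obtain ⟨c0, d0, hc0, hg0⟩ := hf_sound hf
    obtain ⟨c, d, hc, hg⟩ := pull_HS τ hc0 d0
    obtain ⟨e₁, e₂, hD⟩ := ind_dual hI
    have e := Q_add c₁ c₂ 1 0
    simp only [Matrix.cons_val, Q] at b1 b2 e
    rw [hg0, hg] at b1 b2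
    rw [hg0, hg]
    simp only [add_zero, Rat.cast_one, Rat.cast_zero] at b1 b2 e
    simp only [Q, Rat.cast_one]
    rw [e]
    exact uniqB hD hc b1.1 b1.2 b2.1 b2.2

theorem G_neg {c : Fin 3 → ℚ} {d : ℚ} (hc : c ≠ 0) (h : G c d) : G (-c) (-d) := by
  unfold G
  rw [← Q_compl hc]
  exact good_compl h

theorem ind_symm {a b : Fin 3 → ℚ} (h : Ind a b) : Ind b a := by
  unfold Ind at *
  rw [← cross_anticomm]
  exact neg_ne_zero.2 h

theorem ind_ne {a b : Fin 3 → ℚ} (h : Ind a b) : a ≠ 0 := by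
  rintro rfl
  exact h (by simp)

theorem exists_ind {a : Fin 3 → ℚ} (h : a ≠ 0) : ∃ i, Ind a (ev i) := by
  by_contra hcon
  push Not at hcon
  apply h
  have h0 := hcon 0
  have h1 := hcon 1
  simp only [Ind, not_not, cross_apply] at h0 h1
  have a0 := congrFun h0 1
  have a1 := congrFun h0 2
  have a2 := congrFun h1 2
  simp [ev] at a0 a1 a2
  ext i
  fin_cases i <;> simp [*]

def P (l : Fin 3 → ℚ) : Prop := G l 0 ∧ G l 1

theorem P_ev (i : Fin 3) : P (ev i) := ⟨good_frame (i, false), good_frame (i, true)⟩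

theorem P_add {a b : Fin 3 → ℚ} (hI : Ind a b) (ha : P a) (hb : P b) : P (a + b) := by
  have h1 := G_B hI ha.1 ha.2 hb.1 hb.2
  have h0 := G_A hI ha.1 hb.1 h1
  rw [add_zero] at h0
  exact ⟨h0, h1⟩

theorem P_neg {a : Fin 3 → ℚ} (hne : a ≠ 0) (ha : P a) : P (-a) := by
  obtain ⟨i, hi⟩ := exists_ind hne
  have h0 := G_neg hne ha.1
  rw [neg_zero] at h0
  refine ⟨h0, ?_⟩
  have hs := P_add hi ha (P_ev i)
  have hI : Ind (a + ev i) (-ev i) := by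
    unfold Ind at *
    have hj : crossProduct (ev i) a ≠ 0 := ind_symm hi
    simpa [map_add] using hj
  have := G_A hI hs.1 (G_neg (ev_ne i) (P_ev i).2) (w := 0) (by simpa using ha.1)
  simp only [add_neg_cancel_right, zero_add] at this
  have := G_neg hne this
  simpa using this

theorem para {a b e : Fin 3 → ℚ} (h : a ≠ 0) (hb : crossProduct a b = 0)
    (he : crossProduct a e = 0) : crossProduct b e = 0 := by
  obtain ⟨k, hk⟩ := Function.ne_iff.1 h
  have hk : a k ≠ 0 := hk
  have key : ∀ b : Fin 3 → ℚ, crossProduct a b = 0 → a k • b = b k • a := by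
    intro b hb
    rw [cross_apply] at hb
    have b0 := congrFun hb 0
    have b1 := congrFun hb 1
    have b2 := congrFun hb 2
    simp at b0 b1 b2
    ext j
    fin_cases k <;> fin_cases j <;> simp <;> linarith
  have h2 : crossProduct (a k • b) (a k • e) = 0 := by
    rw [key b hb, key e he]
    simp
  simpa [hk] using h2

theorem P_add' {a b : Fin 3 → ℚ} (ha0 : a ≠ 0) (hb0 : b ≠ 0) (h0 : a + b ≠ 0)
    (ha : P a) (hb : P b) : P (a + b) := by
  by_cases hI : Ind a b
  · exact P_add hI ha hb
  obtain ⟨i, hi⟩ := exists_ind h0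
  have hab : crossProduct a b = 0 := not_not.1 hI
  have hai : Ind a (ev i) := by
    intro h
    apply hi
    rw [map_add, LinearMap.add_apply, h, para ha0 hab h, add_zero]
  have hba : crossProduct b a = 0 := by rw [← cross_anticomm, hab, neg_zero]
  have hbi : Ind b (-ev i) := by
    intro h
    rw [map_neg, neg_eq_zero] at h
    apply hi
    rw [map_add, LinearMap.add_apply, h, para hb0 hba h, add_zero]
  have h1 := P_add hai ha (P_ev i)
  have h2 := P_add hbi hb (P_neg (ev_ne i) (P_ev i))
  have hII : Ind (a + ev i) (b + -ev i) := by
    have e : crossProduct (a + ev i) (b + -ev i) = - crossProduct (a + b) (ev i) := by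
      simp only [map_add, LinearMap.add_apply, map_neg, hab, cross_self]
      rw [← cross_anticomm b (ev i)]
      abel
    unfold Ind
    rw [e]
    exact neg_ne_zero.2 hi
  have := P_add hII h1 h2
  have e : a + ev i + (b + -ev i) = a + b := by abel
  rwa [e] at this

theorem P_int (n : Fin 3 → ℤ) (h : (fun i => (n i : ℚ)) ≠ 0) : P (fun i => (n i : ℚ)) := by
  let T : AddSubgroup (Fin 3 → ℚ) :=
    { carrier := {l | l ≠ 0 → P l}
      zero_mem' := fun h => (h rfl).elim
      add_mem' := by
        intro a b ha hb hab
        by_cases ha0 : a = 0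
        · subst ha0; rw [zero_add] at *; exact hb hab
        by_cases hb0 : b = 0
        · subst hb0; rw [add_zero] at *; exact ha hab
        exact P_add' ha0 hb0 hab (ha ha0) (hb hb0)
      neg_mem' := by
        intro a ha h
        have h' : a ≠ 0 := neg_ne_zero.1 h
        exact P_neg h' (ha h') }
  have hT : (fun i => (n i : ℚ)) ∈ T := by
    have e : (fun i => (n i : ℚ)) = ∑ i, n i • ev i := by
      ext j
      simp [ev, Finset.sum_apply, Pi.single_apply]
    rw [e]
    exact T.sum_mem fun i _ => T.zsmul_mem (show ev i ∈ T from fun _ => P_ev i) _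
  exact hT h

theorem G_nat (k : ℕ) : ∀ (n : Fin 3 → ℤ), (fun i => (n i : ℚ)) ≠ 0 →
    G (fun i => (n i : ℚ)) k := by
  induction k with
  | zero => intro n h; simpa using (P_int n h).1
  | succ k ih =>
    intro n h
    obtain ⟨i, hi⟩ := exists_ind h
    have e : (fun j => ((n - Pi.single i 1 : Fin 3 → ℤ) j : ℚ)) =
        (fun j => (n j : ℚ)) + -ev i := by
      ext j
      by_cases hj : j = i
      · subst hj; simp [ev, sub_eq_add_neg]
      · simp [ev, hj]
    have hI : Ind ((fun j => (n j : ℚ)) + -ev i) (ev i) := by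
      unfold Ind at *
      simpa [map_add] using hi
    have h1 := ih (n - Pi.single i 1) (by rw [e]; exact ind_ne hI)
    rw [e] at h1
    have := G_A hI h1 (P_ev i).2 (w := 0) (by simpa using (P_int n h).1)
    simpa using this

theorem G_int (n : Fin 3 → ℤ) (m : ℤ) (h : (fun i => (n i : ℚ)) ≠ 0) :
    G (fun i => (n i : ℚ)) m := by
  obtain ⟨k, rfl | rfl⟩ := m.eq_nat_or_neg
  · exact_mod_cast G_nat k n h
  · have e : (fun j => ((-n : Fin 3 → ℤ) j : ℚ)) = -(fun j => (n j : ℚ)) := by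
      ext j; simp
    have h1 := G_nat k (-n) (by rw [e]; exact neg_ne_zero.2 h)
    have h2 := G_neg (by rw [e]; exact neg_ne_zero.2 h) h1
    rw [e, neg_neg] at h2
    simpa using h2

theorem clear_den {q : ℚ} {K : ℕ} (h : q.den ∣ K) : ∃ m : ℤ, (m : ℚ) = K * q := by
  obtain ⟨l, rfl⟩ := h
  refine ⟨l * q.num, ?_⟩
  push_cast
  rw [← Rat.den_mul_eq_num q]
  ring

theorem G_all (c : Fin 3 → ℚ) (d : ℚ) (hc : c ≠ 0) : G c d := by
  obtain ⟨N, hN, n, m, hn, hm⟩ : ∃ N : ℚ, 0 < N ∧ ∃ (n : Fin 3 → ℤ) (m : ℤ),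
      (∀ i, (n i : ℚ) = N * c i) ∧ (m : ℚ) = N * d := by
    let K : ℕ := (∏ i, (c i).den) * d.den
    have hK : 0 < K := Nat.mul_pos (Finset.prod_pos fun i _ => (c i).den_pos) d.den_pos
    have h1 : ∀ i, ∃ m : ℤ, (m : ℚ) = K * c i := fun i => clear_den
      ((Finset.dvd_prod_of_mem (fun i => (c i).den) (Finset.mem_univ i)).trans (Nat.dvd_mul_right _ _))
    have h2 : ∃ m : ℤ, (m : ℚ) = K * d := clear_den (Nat.dvd_mul_left _ _)
    choose n hn using h1
    obtain ⟨m, hm⟩ := h2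
    exact ⟨K, by exact_mod_cast hK, n, m, hn, hm⟩
  have e : (fun i => (n i : ℚ)) = N • c := by ext i; simp [hn]
  have h := G_int n m (by rw [e]; exact smul_ne_zero hN.ne' hc)
  unfold G Q at *
  have e2 : (fun i => ((n i : ℚ) : ℝ)) = (N : ℝ) • (fun i => (c i : ℝ)) := by
    ext i; rw [hn]; simp
  rw [hm] at h
  push_cast at h
  have e3 : (fun i => (n i : ℝ)) = (N : ℝ) • (fun i => (c i : ℝ)) := by
    rw [← e2]; ext i; simp
  rw [e3, HS_smul _ _ (by exact_mod_cast hN)] at h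
  exact h

theorem good_all {r : Set E} (h : InROQ 3 r) : Good r := by
  induction h with
  | bot => exact good_bot
  | top => exact good_top
  | halfspace s h =>
    obtain ⟨c, d, hc, rfl⟩ := h
    exact G_all c d hc
  | inf s t _ _ hs ht => exact good_inf hs ht
  | sup s t _ _ hs ht => exact good_sup hs ht
  | compl s _ hs => exact good_compl hs

/-! ### Frames -/

/-- The frame condition. -/
def Frame (F : Idx → M) : Prop :=
  (∀ p, Hf (F p)) ∧
  (∀ i : Fin 3, le (F (i, false)) (F (i, true)) ∧ ¬ le (F (i, true)) (F (i, false))) ∧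
  ∀ s : Fin 3 → Bool, ∃ d : M, ¬ IsBot d ∧ ∀ i,
    (if s i then le d (F (i, false)) else Disj d (F (i, false)))

theorem D.frame {α : Type} (f : Idx → α) : D (fun v : α → M => Frame (fun p => v (f p))) := by
  unfold Frame
  refine D.and (D.fin fun p => D.hf (f p)) (D.and (D.fin fun i =>
    D.and (D.le (f (i, false)) (f (i, true))) (D.not (D.le (f (i, true)) (f (i, false)))))
    (D.fin fun s => D.ex (D.and (D.not (D.isBot _)) (D.fin fun i => ?_))))
  cases s i
  · simpa using D.disj (Sum.inr ()) (Sum.inl (f (i, false)))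
  · simpa using D.le (Sum.inr ()) (Sum.inl (f (i, false)))

theorem castev (i : Fin 3) (x : E) : (fun j => ((ev i j : ℚ) : ℝ)) ⬝ᵥ x = x i := by
  have : (fun j => ((ev i j : ℚ) : ℝ)) = Pi.single i 1 := by
    ext j
    by_cases hj : j = i
    · subst hj; simp [ev]
    · simp [ev, hj]
  rw [this, single_dotProduct, one_mul]

theorem F0_false (i : Fin 3) (x : E) : x ∈ (F0 (i, false)).1 ↔ x i < 0 := by
  show x ∈ Q (ev i) (if false = true then 1 else 0) ↔ _
  rw [mem_Q, castev]
  simp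

theorem F0_true (i : Fin 3) (x : E) : x ∈ (F0 (i, true)).1 ↔ x i < 1 := by
  show x ∈ Q (ev i) (if true = true then 1 else 0) ↔ _
  rw [mem_Q, castev]
  simp

theorem frame_F0 : Frame F0 := by
  refine ⟨fun p => hf_complete (ev_ne _) _ rfl, fun i => ⟨?_, ?_⟩, ?_⟩
  · intro x hx
    rw [F0_false] at hx
    rw [F0_true]
    linarith
  · intro h
    have : (0 : E) ∈ (F0 (i, false)).1 := h ((F0_true i 0).2 (by simp))
    rw [F0_false] at this
    simp at this
  · intro s
    let q : Fin 3 → Set E := fun i => if s i then Q (ev i) 0 else Q (-ev i) (-0)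
    have hq : ∀ i, InROQ 3 (q i) := by
      intro i
      simp only [q]
      split_ifs
      · exact Q_roq (ev_ne i) _
      · exact Q_roq (neg_ne_zero.2 (ev_ne i)) _
    have hq1 : ∀ i, s i = true → q i = (F0 (i, false)).1 := by
      intro i h
      simp [q, h, F0]
    have hq2 : ∀ i, s i = false → q i = interior ((F0 (i, false)).1)ᶜ := by
      intro i h
      simp only [q, h, F0]
      rw [← Q_compl (ev_ne i)]
      simp
    obtain ⟨d, hd⟩ : ∃ d : M, d.1 = q 0 ∩ (q 1 ∩ q 2) :=
      ⟨⟨_, InROQ.inf _ _ (hq 0) (InROQ.inf _ _ (hq 1) (hq 2))⟩, rfl⟩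
    have hdi : ∀ i, d.1 ⊆ q i := by
      intro i x hx
      rw [hd] at hx
      fin_cases i
      · exact hx.1
      · exact hx.2.1
      · exact hx.2.2
    refine ⟨d, ?_, ?_⟩
    · rw [isBot_iff, ← Ne, ← Set.nonempty_iff_ne_empty, hd]
      let x : E := fun i => if s i then -1 else 1
      have hx : ∀ i, x ∈ q i := by
        intro i
        cases h : s i
        · simp only [q, h]
          rw [if_neg (by simp), mem_Q]
          have := castev i x
          have e : (fun j => (((-ev i) j : ℚ) : ℝ)) = -(fun j => ((ev i j : ℚ) : ℝ)) := by
            ext j; simp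
          rw [e, neg_dotProduct, this]
          simp [x, h]
        · simp only [q, h]
          rw [if_pos trivial, mem_Q, castev]
          simp [x, h]
      exact ⟨x, hx 0, hx 1, hx 2⟩
    · intro i
      cases h : s i
      · rw [if_neg (by simp), disj_iff, ← sub_int_compl (open_of_roq d.2), ← hq2 i h]
        exact hdi i
      · rw [if_pos rfl]
        unfold le
        rw [← hq1 i h]
        exact hdi i

theorem frame_sound {F : Idx → M} (h : Frame F) :
    ∃ τ : Aff, ∀ p, (F p).1 = τ '' (F0 p).1 := by
  obtain ⟨hH, hle, hpat⟩ := h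
  have hH0 := fun i => hf_sound (hH (i, false))
  choose c d hc hF using hH0
  have hk : ∀ i, ∃ κ : ℝ, 0 < κ ∧ (F (i, true)).1 = HS (c i) (d i + κ) := by
    intro i
    obtain ⟨c', d', hc', hF'⟩ := hf_sound (hH (i, true))
    have h1 : HS (c i) (d i) ⊆ HS c' d' := by rw [← hF, ← hF']; exact (hle i).1
    obtain ⟨t, ht, hct, -⟩ := HS_sub (hc i) hc' h1
    have e : (F (i, true)).1 = HS (c i) (d' / t) := by
      rw [hF', hct, ← HS_smul (c i) (d' / t) ht, mul_div_cancel₀ _ ht.ne']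
    refine ⟨d' / t - d i, ?_, by rw [e]; congr 1; ring⟩
    by_contra hn
    apply (hle i).2
    unfold le
    rw [e, hF]
    intro x hx
    have hx : c i ⬝ᵥ x < d' / t := hx
    show c i ⬝ᵥ x < d i
    linarith
  choose κ hκ hFt using hk
  have hp : ∀ s : Fin 3 → Bool, ∃ x : E, ∀ i,
      if s i then c i ⬝ᵥ x < d i else d i < c i ⬝ᵥ x := by
    intro s
    obtain ⟨e, he, h⟩ := hpat s
    rw [isBot_iff, ← Ne, ← Set.nonempty_iff_ne_empty] at he
    obtain ⟨x, hx⟩ := he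
    refine ⟨x, fun i => ?_⟩
    have hi := h i
    cases hs : s i
    · rw [hs, if_neg (by simp), disj_iff, ← sub_int_compl (open_of_roq e.2), hF,
        HS_compl (hc i)] at hi
      have := hi hx
      simpa [HS] using this
    · rw [hs, if_pos rfl] at hi
      have := hi hx
      rw [hF] at this
      simpa [HS] using this
  let A : Matrix (Fin 3) (Fin 3) ℝ := Matrix.of c
  have hdet : A.det ≠ 0 := by
    intro h0
    obtain ⟨μ, hμ0, hμ⟩ := Matrix.exists_vecMul_eq_zero_iff.2 h0
    have hsum : ∀ x : E, ∑ i, μ i * (c i ⬝ᵥ x) = 0 := by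
      intro x
      have h1 : μ ⬝ᵥ (A.mulVec x) = 0 := by
        rw [Matrix.dotProduct_mulVec, hμ, zero_dotProduct]
      exact h1
    obtain ⟨k, hk⟩ := Function.ne_iff.1 hμ0
    have hk : μ k ≠ 0 := hk
    obtain ⟨x, hx⟩ := hp (fun i => decide (0 < μ i))
    obtain ⟨y, hy⟩ := hp (fun i => decide (μ i < 0))
    have hx1 : ∑ i, μ i * (c i ⬝ᵥ x) < ∑ i, μ i * d i := by
      have key : ∀ i, μ i * (c i ⬝ᵥ x) ≤ μ i * d i ∧
          (μ i ≠ 0 → μ i * (c i ⬝ᵥ x) < μ i * d i) := by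
        intro i
        have := hx i
        rcases lt_trichotomy (μ i) 0 with h | h | h
        · simp only [decide_eq_true_eq, not_lt.2 h.le, if_false] at this
          have := mul_lt_mul_of_neg_left this h
          exact ⟨this.le, fun _ => this⟩
        · simp [h]
        · simp only [decide_eq_true_eq, h, if_true] at this
          have := mul_lt_mul_of_pos_left this h
          exact ⟨this.le, fun _ => this⟩
      exact Finset.sum_lt_sum (fun i _ => (key i).1) ⟨k, Finset.mem_univ k, (key k).2 hk⟩
    have hy1 : ∑ i, μ i * d i < ∑ i, μ i * (c i ⬝ᵥ y) := by
      have key : ∀ i, μ i * d i ≤ μ i * (c i ⬝ᵥ y) ∧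
          (μ i ≠ 0 → μ i * d i < μ i * (c i ⬝ᵥ y)) := by
        intro i
        have := hy i
        rcases lt_trichotomy (μ i) 0 with h | h | h
        · simp only [decide_eq_true_eq, h, if_true] at this
          have := mul_lt_mul_of_neg_left this h
          exact ⟨this.le, fun _ => this⟩
        · simp [h]
        · simp only [decide_eq_true_eq, not_lt.2 h.le, if_false] at this
          have := mul_lt_mul_of_pos_left this h
          exact ⟨this.le, fun _ => this⟩
      exact Finset.sum_lt_sum (fun i _ => (key i).1) ⟨k, Finset.mem_univ k, (key k).2 hk⟩
    rw [hsum] at hx1 hy1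
    linarith
  have hAu : IsUnit A := (Matrix.isUnit_iff_isUnit_det A).2 (isUnit_iff_ne_zero.2 hdet)
  -- the inverse of the wanted transformation
  let σ : E →ᵃ[ℝ] E :=
    { toFun := fun x i => (c i ⬝ᵥ x - d i) / κ i
      linear :=
        { toFun := fun x i => (c i ⬝ᵥ x) / κ i
          map_add' := fun x y => by ext i; simp [dotProduct_add, add_div]
          map_smul' := fun t x => by ext i; simp [dotProduct_smul, mul_div_assoc] }
      map_vadd' := fun p v => by
        ext i
        simp [dotProduct_add, add_div, sub_div, add_sub_assoc] }
  have hσ : ∀ x i, σ x i = (c i ⬝ᵥ x - d i) / κ i := fun x i => rfl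
  have hbij : Function.Bijective σ := by
    constructor
    · intro x y hxy
      apply Matrix.mulVec_injective_of_isUnit hAu
      ext i
      have := congrFun hxy i
      rw [hσ, hσ, div_left_inj' (hκ i).ne'] at this
      show c i ⬝ᵥ x = c i ⬝ᵥ y
      linarith
    · intro y
      obtain ⟨x, hx⟩ := Matrix.mulVec_surjective_iff_isUnit.2 hAu (fun i => y i * κ i + d i)
      refine ⟨x, ?_⟩
      ext i
      have : c i ⬝ᵥ x = y i * κ i + d i := congrFun hx i
      have := (hκ i).ne'
      rw [hσ, ‹c i ⬝ᵥ x = _›]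
      field_simp
      ring
  let e : Aff := AffineEquiv.ofBijective hbij
  have he : ∀ x, e x = σ x := fun x => rfl
  refine ⟨e.symm, ?_⟩
  have key : ∀ s : Set E, e.symm '' s = {x | σ x ∈ s} := by
    intro s
    ext x
    constructor
    · rintro ⟨y, hy, rfl⟩
      show σ (e.symm y) ∈ s
      rw [← he, AffineEquiv.apply_symm_apply]
      exact hy
    · intro hx
      exact ⟨σ x, hx, by rw [← he, AffineEquiv.symm_apply_apply]⟩
  rintro ⟨i, b⟩
  rw [key]
  ext x
  cases b
  · rw [hF]
    show c i ⬝ᵥ x < d i ↔ σ x ∈ (F0 (i, false)).1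
    rw [F0_false, hσ, div_lt_iff₀ (hκ i), zero_mul, sub_neg]
  · rw [hFt]
    show c i ⬝ᵥ x < d i + κ i ↔ σ x ∈ (F0 (i, true)).1
    rw [F0_true, hσ, div_lt_iff₀ (hκ i), one_mul, sub_lt_iff_lt_add']

theorem aff_isAffineEquiv (τ : Aff) : IsAffineEquiv 3 τ := by
  refine ⟨LinearMap.toMatrix' (τ.linear : E →ₗ[ℝ] E), τ 0, ?_, ?_⟩
  · rw [LinearMap.det_toMatrix']
    exact LinearEquiv.isUnit_det' τ.linear
  · intro x
    rw [LinearMap.toMatrix'_mulVec]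
    have := τ.map_vadd 0 x
    simpa using this

end ACF

/-- Every region of ROQ(ℝ³) satisfies an affine-complete formula in 𝔐³: any two regions
satisfying it are related by an affine transformation of ℝ³. -/
theorem affine_complete_formula_dim3 (r : ROQel 3) :
    ∃ φ : Lconv.Formula (Fin 1),
      φ.Realize ![r] ∧
      ∀ r' r'' : ROQel 3, φ.Realize ![r'] → φ.Realize ![r''] →
        ∃ τ : (Fin 3 → ℝ) → (Fin 3 → ℝ), IsAffineEquiv 3 τ ∧ τ '' r'.1 = r''.1 := by
  obtain ⟨S, hD, ⟨g, hg, hS⟩, hu⟩ := ACF.good_all r.2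
  obtain rfl : g = r := Subtype.ext hg
  obtain ⟨φ, hφ⟩ := ACF.D.exs (α := Fin 1) (β := ACF.Idx)
    (P := fun v F => ACF.Frame F ∧ S F (v 0))
    (ACF.D.and (ACF.D.frame Sum.inr) (hD _ Sum.inr (Sum.inl 0)))
  refine ⟨φ, (hφ _).2 ⟨ACF.F0, ACF.frame_F0, hS⟩, ?_⟩
  intro r' r'' h' h''
  obtain ⟨F', hF', hS'⟩ := (hφ _).1 h'
  obtain ⟨F'', hF'', hS''⟩ := (hφ _).1 h''
  obtain ⟨σ₁, hσ₁⟩ := ACF.frame_sound hF'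
  obtain ⟨σ₂, hσ₂⟩ := ACF.frame_sound hF''
  have e' : r'.1 = σ₁ '' g.1 := hu σ₁ F' r' hσ₁ hS'
  have e'' : r''.1 = σ₂ '' g.1 := hu σ₂ F'' r'' hσ₂ hS''
  refine ⟨σ₁.symm.trans σ₂, ACF.aff_isAffineEquiv _, ?_⟩
  rw [e', e'', Set.image_image]
  simp
end

section
/- For every k ≥ 1, every k-tuple (r_1, …, r_k) of elements of ROQ(ℝ²) satisfies an L_{conv,≤}-formula φ(x_1, …, x_k) with the following property: for any two k-tuples (s_1, …, s_k) and (s'_1, …, s'_k) of elements of ROQ(ℝ²) satisfying φ in 𝔐², there exists an affine transformation τ of ℝ² with τ(s_i) = s'_i for all i = 1, …, k. -/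
open FirstOrder

namespace AffC

open FirstOrder Language

abbrev M := ROQel 2

abbrev Leq (a b : M) : Prop := a.1 ⊆ b.1

theorem leq_antisymm {a b : M} (h : Leq a b) (h' : Leq b a) : a = b :=
  Subtype.ext (Set.Subset.antisymm h h')

/-- `P` is first-order definable in 𝔐² with parameters `F`. -/
def D {ι α : Type} (F : ι → M) (P : (α → M) → Prop) : Prop :=
  ∃ φ : Lconv.Formula (ι ⊕ α), ∀ v, φ.Realize (Sum.elim F v) ↔ P v

section logic

variable {ι α β : Type} {F : ι → M}

theorem D.congr {P Q : (α → M) → Prop} (h : D F P) (e : ∀ v, P v ↔ Q v) : D F Q := by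
  obtain ⟨φ, hφ⟩ := h
  exact ⟨φ, fun v => (hφ v).trans (e v)⟩

theorem D.not {P : (α → M) → Prop} (h : D F P) : D F (fun v => ¬ P v) := by
  obtain ⟨φ, hφ⟩ := h
  exact ⟨φ.not, fun v => by rw [Formula.realize_not, hφ]⟩

theorem D.and {P Q : (α → M) → Prop} (h : D F P) (h' : D F Q) : D F (fun v => P v ∧ Q v) := by
  obtain ⟨φ, hφ⟩ := h
  obtain ⟨ψ, hψ⟩ := h'
  exact ⟨φ ⊓ ψ, fun v => by rw [Formula.realize_inf, hφ, hψ]⟩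

theorem D.or {P Q : (α → M) → Prop} (h : D F P) (h' : D F Q) : D F (fun v => P v ∨ Q v) :=
  (h.not.and h'.not).not.congr (fun v => by tauto)

theorem D.imp {P Q : (α → M) → Prop} (h : D F P) (h' : D F Q) : D F (fun v => P v → Q v) :=
  (h.and h'.not).not.congr (fun v => by tauto)

theorem D.iff {P Q : (α → M) → Prop} (h : D F P) (h' : D F Q) : D F (fun v => P v ↔ Q v) :=
  ((h.imp h').and (h'.imp h)).congr (fun v => by tauto)

theorem D.relabel {P : (α → M) → Prop} (h : D F P) (f : α → β) :
    D F (fun v : β → M => P (fun a => v (f a))) := by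
  obtain ⟨φ, hφ⟩ := h
  refine ⟨Formula.relabel (Sum.map id f) φ, fun v => ?_⟩
  rw [Formula.realize_relabel]
  have : Sum.elim F v ∘ Sum.map id f = Sum.elim F (fun a => v (f a)) := by
    funext x; cases x <;> rfl
  rw [this]
  exact hφ _

theorem D.ex {P : (α → M) → M → Prop}
    (h : D F (fun w : Option α → M => P (fun a => w (some a)) (w none))) :
    D F (fun v => ∃ x, P v x) := by
  obtain ⟨φ, hφ⟩ := h
  let f : ι ⊕ Option α → (ι ⊕ α) ⊕ Unit := fun x => match x with
    | .inl i => .inl (.inl i)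
    | .inr none => .inr ()
    | .inr (some a) => .inl (.inr a)
  refine ⟨Formula.iExs Unit (Formula.relabel f φ), fun v => ?_⟩
  rw [Formula.realize_iExs]
  have key : ∀ u : Unit → M, Sum.elim (Sum.elim F v) u ∘ f
      = Sum.elim F (fun o : Option α => o.elim (u ()) v) := by
    intro u; funext x; rcases x with i | (_ | a) <;> rfl
  constructor
  · rintro ⟨u, hu⟩
    rw [Formula.realize_relabel, key, hφ] at hu
    exact ⟨u (), hu⟩
  · rintro ⟨x, hx⟩
    refine ⟨fun _ => x, ?_⟩
    rw [Formula.realize_relabel, key, hφ]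
    exact hx

theorem D.all {P : (α → M) → M → Prop}
    (h : D F (fun w : Option α → M => P (fun a => w (some a)) (w none))) :
    D F (fun v => ∀ x, P v x) :=
  (D.ex (P := fun v x => ¬ P v x) h.not).not.congr (fun v => by push Not; rfl)

theorem D.le0 (a b : α) : D F (fun v => Leq (v a) (v b)) :=
  ⟨Relations.formula₂ (L := Lconv) (show Lconv.Relations 2 from ())
    (Term.var (Sum.inr a)) (Term.var (Sum.inr b)), fun v => by
    rw [Formula.realize_rel₂]; rfl⟩

theorem D.conv0 (a : α) : D F (fun v => Convex ℝ (v a).1) :=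
  ⟨Relations.formula₁ (L := Lconv) (show Lconv.Relations 1 from ())
    (Term.var (Sum.inr a)), fun v => by
    rw [Formula.realize_rel₁]; rfl⟩

/-- Definable functions. -/
def T (F : ι → M) (t : (α → M) → M) : Prop :=
  D F (fun w : Option α → M => w none = t (fun a => w (some a)))

theorem D.subst {P : (α → M) → M → Prop} {t : (α → M) → M}
    (h : D F (fun w : Option α → M => P (fun a => w (some a)) (w none))) (ht : T F t) :
    D F (fun v => P v (t v)) :=
  (D.ex (P := fun v x => x = t v ∧ P v x) (ht.and h)).congr (fun v => by simp)

theorem T.relabel {t : (α → M) → M} (h : T F t) (f : α → β) :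
    T F (fun v : β → M => t (fun a => v (f a))) :=
  D.relabel (β := Option β) h (Option.map f)

theorem T.var (a : α) : T F (fun v => v a) :=
  ((D.le0 none (some a)).and (D.le0 (some a) none)).congr (fun v =>
    ⟨fun h => leq_antisymm h.1 h.2, fun h => by rw [h]; exact ⟨subset_rfl, subset_rfl⟩⟩)

theorem T.par (i : ι) : T F (fun _ : α → M => F i) := by
  have h1 : D F (fun w : Option α → M => Leq (w none) (F i)) :=
    ⟨Relations.formula₂ (L := Lconv) (show Lconv.Relations 2 from ())
      (Term.var (Sum.inr none)) (Term.var (Sum.inl i)), fun v => by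
      rw [Formula.realize_rel₂]; rfl⟩
  have h2 : D F (fun w : Option α → M => Leq (F i) (w none)) :=
    ⟨Relations.formula₂ (L := Lconv) (show Lconv.Relations 2 from ())
      (Term.var (Sum.inl i)) (Term.var (Sum.inr none)), fun v => by
      rw [Formula.realize_rel₂]; rfl⟩
  exact (h1.and h2).congr (fun v =>
    ⟨fun h => leq_antisymm h.1 h.2, fun h => by rw [h]; exact ⟨subset_rfl, subset_rfl⟩⟩)

theorem D.le {t s : (α → M) → M} (ht : T F t) (hs : T F s) : D F (fun v => Leq (t v) (s v)) := by
  refine D.subst (P := fun v x => Leq x (s v)) ?_ ht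
  refine D.subst (P := fun (v : Option α → M) x => Leq (v none) x) ?_ (hs.relabel some)
  exact D.le0 (some none) none

theorem D.eq {t s : (α → M) → M} (ht : T F t) (hs : T F s) : D F (fun v => t v = s v) :=
  ((D.le ht hs).and (D.le hs ht)).congr (fun v =>
    ⟨fun h => leq_antisymm h.1 h.2, fun h => by rw [h]; exact ⟨subset_rfl, subset_rfl⟩⟩)

theorem D.conv {t : (α → M) → M} (ht : T F t) : D F (fun v => Convex ℝ (t v).1) :=
  D.subst (P := fun _ x => Convex ℝ x.1) (D.conv0 none) ht

/-- Definable classes. -/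
def DC (F : ι → M) (K : M → Prop) : Prop := D F (fun v : Unit → M => K (v ()))

theorem DC.app {K : M → Prop} (h : DC F K) {t : (α → M) → M} (ht : T F t) :
    D F (fun v => K (t v)) :=
  D.subst (P := fun _ x => K x) (D.relabel h (fun _ => none)) ht

/-- Definable elements. -/
def De (F : ι → M) (r : M) : Prop := DC F (fun x => x = r)

theorem De.T {r : M} (h : De F r) : T F (fun _ : α → M => r) :=
  DC.app h (T.var none)

theorem De.of_T {r : M} (h : AffC.T F (fun _ : Unit → M => r)) : De F r :=
  D.subst (α := Unit) (P := fun v x => v () = x) (D.eq (T.var (some ())) (T.var none)) h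

/-- Boolean operations -/
def bot : M := ⟨∅, InROQ.bot⟩
def top : M := ⟨Set.univ, InROQ.top⟩
def cpl (a : M) : M := ⟨interior a.1ᶜ, InROQ.compl _ a.2⟩
def inf (a b : M) : M := ⟨a.1 ∩ b.1, InROQ.inf _ _ a.2 b.2⟩

theorem inROQ_open {s : Set (Fin 2 → ℝ)} (h : InROQ 2 s) : IsOpen s := by
  induction h with
  | bot => exact isOpen_empty
  | top => exact isOpen_univ
  | halfspace s hs =>
    obtain ⟨c, d, -, rfl⟩ := hs
    exact isOpen_lt (by fun_prop) continuous_const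
  | inf s t _ _ h1 h2 => exact h1.inter h2
  | sup s t _ _ _ _ => exact isOpen_interior
  | compl s _ _ => exact isOpen_interior

theorem T.bot : T F (fun _ : α → M => bot) := by
  refine (D.all (P := fun (v : Option α → M) x => Leq (v none) x) (D.le0 (some none) none)).congr ?_
  intro v
  refine ⟨fun h => leq_antisymm (h _) (Set.empty_subset _), fun h x => ?_⟩
  rw [h]; exact Set.empty_subset _

theorem T.top : T F (fun _ : α → M => top) := by
  refine (D.all (P := fun (v : Option α → M) x => Leq x (v none)) (D.le0 none (some none))).congr ?_
  intro v
  refine ⟨fun h => leq_antisymm (Set.subset_univ _) (h _), fun h x => ?_⟩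
  rw [h]; exact Set.subset_univ _

theorem T.inf {t s : (α → M) → M} (ht : T F t) (hs : T F s) : T F (fun v => inf (t v) (s v)) := by
  refine (D.all (P := fun (v : Option α → M) x =>
    (Leq x (v none) ↔ Leq x (t (fun a => v (some a))) ∧ Leq x (s (fun a => v (some a)))))
    ?_).congr ?_
  · exact D.iff (D.le0 _ _) ((D.le (T.var _) (ht.relabel _)).and (D.le (T.var _) (hs.relabel _)))
  · intro v
    constructor
    · intro h
      apply leq_antisymm
      · exact Set.subset_inter ((h _).1 subset_rfl).1 ((h _).1 subset_rfl).2
      · exact (h _).2 ⟨Set.inter_subset_left, Set.inter_subset_right⟩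
    · intro h x
      rw [h]
      exact Set.subset_inter_iff

theorem leq_cpl (x y : M) : Leq x (cpl y) ↔ AffC.inf x y = AffC.bot := by
  unfold Leq cpl
  rw [(inROQ_open x.2).subset_interior_iff, Set.subset_compl_iff_disjoint_right,
    Set.disjoint_iff_inter_eq_empty]
  exact ⟨fun h => Subtype.ext h, fun h => congrArg Subtype.val h⟩

theorem T.cpl {t : (α → M) → M} (ht : T F t) : T F (fun v => cpl (t v)) := by
  refine (D.all (P := fun (v : Option α → M) x =>
    (Leq x (v none) ↔ AffC.inf x (t (fun a => v (some a))) = AffC.bot))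
    ?_).congr ?_
  · exact D.iff (D.le0 _ _) (D.eq (T.inf (T.var _) (ht.relabel _)) T.bot)
  · intro v
    constructor
    · intro h
      apply leq_antisymm
      · rw [leq_cpl]; exact (h _).1 subset_rfl
      · rw [h, ← leq_cpl]
    · intro h x
      rw [h, leq_cpl]

/-- The half-plane predicate. -/
def HP (x : M) : Prop :=
  Convex ℝ x.1 ∧ Convex ℝ (cpl x).1 ∧ x ≠ bot ∧ x ≠ top

theorem D.HP {t : (α → M) → M} (ht : T F t) : D F (fun v => HP (t v)) :=
  (D.conv ht).and ((D.conv ht.cpl).and ((D.eq ht T.bot).not.and (D.eq ht T.top).not))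

end logic

section geom

/-- The set `αx + βy < γ` for real coefficients. -/
def hs (α β γ : ℝ) : Set (Fin 2 → ℝ) := {x | α * x 0 + β * x 1 < γ}

theorem mem_hs {α β γ : ℝ} {x : Fin 2 → ℝ} : x ∈ hs α β γ ↔ α * x 0 + β * x 1 < γ := Iff.rfl

theorem inROQ_hs (α β γ : ℚ) : InROQ 2 (hs α β γ) := by
  by_cases h : α = 0 ∧ β = 0
  · obtain ⟨rfl, rfl⟩ := h
    by_cases hγ : (0 : ℝ) < γ
    · have : hs ((0 : ℚ) : ℝ) ((0 : ℚ) : ℝ) γ = Set.univ := by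
        ext x; simp [mem_hs]; exact_mod_cast hγ
      rw [this]; exact InROQ.top
    · have : hs ((0 : ℚ) : ℝ) ((0 : ℚ) : ℝ) γ = ∅ := by
        ext x; simp [mem_hs]; exact_mod_cast not_lt.1 hγ
      rw [this]; exact InROQ.bot
  · apply InROQ.halfspace
    refine ⟨![α, β], γ, ?_, ?_⟩
    · intro h0
      exact h ⟨by simpa using congrFun h0 0, by simpa using congrFun h0 1⟩
    · ext x; simp [mem_hs, Fin.sum_univ_two]

/-- The half-plane `αx + βy < γ`. -/
def H (α β γ : ℚ) : M := ⟨hs α β γ, inROQ_hs α β γ⟩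

theorem mem_H {α β γ : ℚ} {x : Fin 2 → ℝ} : x ∈ (H α β γ).1 ↔ α * x 0 + β * x 1 < γ := Iff.rfl

theorem exists_H {s : Set (Fin 2 → ℝ)} (h : IsRatHalfSpace 2 s) :
    ∃ α β γ : ℚ, (α ≠ 0 ∨ β ≠ 0) ∧ s = (H α β γ).1 := by
  obtain ⟨c, d, hc, rfl⟩ := h
  refine ⟨c 0, c 1, d, ?_, ?_⟩
  · by_contra! h
    apply hc
    ext i; fin_cases i <;> simp [h]
  · ext x; simp [mem_H, Fin.sum_univ_two]

/-- small perturbation of a point -/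
theorem open_move {U : Set (Fin 2 → ℝ)} (hU : IsOpen U) {x : Fin 2 → ℝ} (hx : x ∈ U)
    (u : Fin 2 → ℝ) : ∃ t : ℝ, 0 < t ∧ x + t • u ∈ U := by
  have hc : Continuous (fun t : ℝ => x + t • u) := by fun_prop
  have : (fun t : ℝ => x + t • u) ⁻¹' U ∈ nhds (0 : ℝ) :=
    (hU.preimage hc).mem_nhds (by simpa using hx)
  obtain ⟨ε, hε, hb⟩ := Metric.mem_nhds_iff.1 this
  refine ⟨ε / 2, by positivity, hb ?_⟩
  rw [Metric.mem_ball, dist_zero_right, Real.norm_eq_abs, abs_of_pos (by positivity)]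
  linarith

theorem interior_compl_hs {α β γ : ℝ} (h : α ≠ 0 ∨ β ≠ 0) :
    interior (hs α β γ)ᶜ = hs (-α) (-β) (-γ) := by
  apply Set.Subset.antisymm
  · intro x hx
    obtain ⟨t, ht, hm⟩ := open_move isOpen_interior hx ![-α, -β]
    have := interior_subset hm
    simp only [mem_hs, Set.mem_compl_iff, Pi.add_apply, Pi.smul_apply, smul_eq_mul,
      Matrix.cons_val_zero, Matrix.cons_val_one] at this ⊢
    have h2 : 0 < α ^ 2 + β ^ 2 := by
      rcases h with h | h <;> positivity
    nlinarith [mul_pos ht h2]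
  · apply interior_maximal
    · intro x hx
      simp only [mem_hs, Set.mem_compl_iff] at hx ⊢
      linarith
    · exact isOpen_lt (by fun_prop) continuous_const

theorem cpl_H {α β γ : ℚ} (h : α ≠ 0 ∨ β ≠ 0) : cpl (H α β γ) = H (-α) (-β) (-γ) := by
  apply Subtype.ext
  have := interior_compl_hs (α := α) (β := β) (γ := γ) (by exact_mod_cast h)
  simp only [cpl, H, this]
  push_cast
  rfl

theorem convex_hs (α β γ : ℝ) : Convex ℝ (hs α β γ) := by
  intro x hx y hy a b ha hb hab
  simp only [mem_hs, Pi.add_apply, Pi.smul_apply, smul_eq_mul] at *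
  have e : α * (a * x 0 + b * y 0) + β * (a * x 1 + b * y 1)
    = a * (α * x 0 + β * x 1) + b * (α * y 0 + β * y 1) := by ring
  have e2 : γ = a * γ + b * γ := by rw [← add_mul, hab, one_mul]
  rw [e]
  rcases ha.lt_or_eq with h | h
  · nlinarith [mul_lt_mul_of_pos_left hx h, mul_le_mul_of_nonneg_left hy.le hb]
  · subst h
    have : b = 1 := by linarith
    subst this; linarith

theorem hs_nonempty {α β : ℝ} (γ : ℝ) (h : α ≠ 0 ∨ β ≠ 0) : (hs α β γ).Nonempty := by
  have h2 : 0 < α ^ 2 + β ^ 2 := by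
    rcases h with h | h <;> positivity
  refine ⟨![((γ - 1) / (α ^ 2 + β ^ 2)) * α, ((γ - 1) / (α ^ 2 + β ^ 2)) * β], ?_⟩
  simp only [mem_hs, Matrix.cons_val_zero, Matrix.cons_val_one]
  have : α * ((γ - 1) / (α ^ 2 + β ^ 2) * α) + β * ((γ - 1) / (α ^ 2 + β ^ 2) * β) = γ - 1 := by
    field_simp
  linarith

theorem HP_H {α β γ : ℚ} (h : α ≠ 0 ∨ β ≠ 0) : HP (H α β γ) := by
  have hR : (α : ℝ) ≠ 0 ∨ (β : ℝ) ≠ 0 := by exact_mod_cast h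
  refine ⟨convex_hs _ _ _, ?_, ?_, ?_⟩
  · rw [cpl_H h]; exact convex_hs _ _ _
  · intro e
    obtain ⟨x, hx⟩ := hs_nonempty (γ : ℝ) hR
    have : x ∈ (H α β γ).1 := hx
    rw [e] at this; exact this
  · intro e
    obtain ⟨x, hx⟩ := hs_nonempty ((-γ : ℚ) : ℝ)
      (α := ((-α : ℚ) : ℝ)) (β := ((-β : ℚ) : ℝ)) (by push_cast; simpa using hR)
    have h1 : x ∈ (H α β γ).1 := by rw [e]; trivial
    rw [mem_H] at h1
    rw [mem_hs] at hx
    push_cast at hx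
    linarith

theorem regular {s : Set (Fin 2 → ℝ)} (h : InROQ 2 s) : interior (closure s) = s := by
  have aux : ∀ C : Set (Fin 2 → ℝ), IsClosed C →
      interior (closure (interior C)) = interior C := by
    intro C hC
    apply Set.Subset.antisymm
    · exact interior_mono (closure_minimal interior_subset hC)
    · exact interior_maximal subset_closure isOpen_interior
  induction h with
  | bot => simp
  | top => simp
  | halfspace s hs' =>
    obtain ⟨α, β, γ, h, rfl⟩ := exists_H hs'
    have e : (H α β γ).1 = interior (H (-α) (-β) (-γ)).1ᶜ := by
      have := cpl_H (α := -α) (β := -β) (γ := -γ) (by simpa using h)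
      rw [neg_neg, neg_neg, neg_neg] at this
      rw [← this]; rfl
    rw [e]
    exact aux _ (inROQ_open (H (-α) (-β) (-γ)).2).isClosed_compl
  | inf s t hs ht h1 h2 =>
    apply Set.Subset.antisymm
    · apply Set.subset_inter
      · conv_rhs => rw [← h1]
        exact interior_mono (closure_mono Set.inter_subset_left)
      · conv_rhs => rw [← h2]
        exact interior_mono (closure_mono Set.inter_subset_right)
    · exact interior_maximal subset_closure ((inROQ_open hs).inter (inROQ_open ht))
  | sup s t _ _ _ _ => exact aux _ isClosed_closure
  | compl s hs _ => exact aux _ (inROQ_open hs).isClosed_compl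

/-- the line `αx + βy = γ` -/
def ln (p : ℚ × ℚ × ℚ) : Set (Fin 2 → ℝ) := {x | p.1 * x 0 + p.2.1 * x 1 = p.2.2}

theorem frontier_lines {s : Set (Fin 2 → ℝ)} (h : InROQ 2 s) :
    ∃ S : Set (ℚ × ℚ × ℚ), S.Finite ∧ (∀ p ∈ S, p.1 ≠ 0 ∨ p.2.1 ≠ 0) ∧
      frontier s ⊆ ⋃ p ∈ S, ln p := by
  induction h with
  | bot => exact ⟨∅, Set.finite_empty, by simp, by simp⟩
  | top => exact ⟨∅, Set.finite_empty, by simp, by simp⟩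
  | halfspace s hs' =>
    obtain ⟨α, β, γ, h, rfl⟩ := exists_H hs'
    refine ⟨{(α, β, γ)}, Set.finite_singleton _, by simpa using h, ?_⟩
    simp only [Set.mem_singleton_iff, Set.iUnion_iUnion_eq_left]
    exact frontier_lt_subset_eq (f := fun x : Fin 2 → ℝ => (α : ℝ) * x 0 + β * x 1)
      (g := fun _ => (γ : ℝ)) (by fun_prop) continuous_const
  | inf s t _ _ h1 h2 =>
    obtain ⟨S, hS, hS', hS''⟩ := h1
    obtain ⟨S2, hS2, hS2', hS2''⟩ := h2
    refine ⟨S ∪ S2, hS.union hS2, ?_, ?_⟩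
    · rintro p (hp | hp)
      exacts [hS' p hp, hS2' p hp]
    · rw [Set.biUnion_union]
      refine (frontier_inter_subset _ _).trans (Set.union_subset_union ?_ ?_)
      · exact Set.inter_subset_left.trans hS''
      · exact Set.inter_subset_right.trans hS2''
  | sup s t _ _ h1 h2 =>
    obtain ⟨S, hS, hS', hS''⟩ := h1
    obtain ⟨S2, hS2, hS2', hS2''⟩ := h2
    refine ⟨S ∪ S2, hS.union hS2, ?_, ?_⟩
    · rintro p (hp | hp)
      exacts [hS' p hp, hS2' p hp]
    · rw [Set.biUnion_union]
      refine frontier_interior_subset.trans (frontier_closure_subset.trans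
        ((frontier_union_subset _ _).trans (Set.union_subset_union ?_ ?_)))
      · exact Set.inter_subset_left.trans hS''
      · exact Set.inter_subset_right.trans hS2''
  | compl s _ h1 =>
    obtain ⟨S, hS, hS', hS''⟩ := h1
    refine ⟨S, hS, hS', frontier_interior_subset.trans ?_⟩
    rwa [frontier_compl]

theorem dual_coord (f : StrongDual ℝ (Fin 2 → ℝ)) (x : Fin 2 → ℝ) :
    f x = f (Pi.single 0 1) * x 0 + f (Pi.single 1 1) * x 1 := by
  have : x = x 0 • (Pi.single 0 1 : Fin 2 → ℝ) + x 1 • (Pi.single 1 1 : Fin 2 → ℝ) := by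
    ext i; fin_cases i <;> simp
  conv_lhs => rw [this]
  rw [map_add, map_smul, map_smul, smul_eq_mul, smul_eq_mul]
  ring

theorem HP_real {x : M} (h : HP x) :
    ∃ α β γ : ℝ, (α ≠ 0 ∨ β ≠ 0) ∧ x.1 = hs α β γ := by
  obtain ⟨h1, h2, h3, h4⟩ := h
  have hxo := inROQ_open x.2
  have hne : x.1.Nonempty := by
    rw [Set.nonempty_iff_ne_empty]; exact fun e => h3 (Subtype.ext e)
  have hreg := regular x.2
  have hcne : (cpl x).1.Nonempty := by
    rw [Set.nonempty_iff_ne_empty]; intro e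
    apply h4
    apply Subtype.ext
    change x.1 = Set.univ
    have e' : interior x.1ᶜ = ∅ := e
    rw [interior_compl, Set.compl_empty_iff] at e'
    rw [← hreg, e', interior_univ]
  have hdisj : Disjoint x.1 (cpl x).1 :=
    Set.disjoint_left.2 (fun y hy hy' => interior_subset hy' hy)
  obtain ⟨f, u, hf1, hf2⟩ := geometric_hahn_banach_open_open h1 hxo h2 (inROQ_open (cpl x).2) hdisj
  refine ⟨f (Pi.single 0 1), f (Pi.single 1 1), u, ?_, ?_⟩
  · by_contra! h0
    obtain ⟨a, ha⟩ := hne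
    obtain ⟨b, hb⟩ := hcne
    have ha := hf1 a ha
    have hb := hf2 b hb
    rw [dual_coord, h0.1, h0.2] at ha hb
    linarith
  · apply Set.Subset.antisymm
    · intro y hy
      rw [mem_hs, ← dual_coord]
      exact hf1 y hy
    · rw [← hreg]
      apply interior_maximal
      · intro y hy
        rw [mem_hs, ← dual_coord] at hy
        by_contra hyn
        have : y ∈ (cpl x).1 := by
          change y ∈ interior x.1ᶜ
          rwa [interior_compl]
        exact absurd (hf2 y this) (by linarith)
      · exact isOpen_lt (by fun_prop) continuous_const

theorem hs_scale {α β γ : ℝ} {l : ℝ} (hl : 0 < l) : hs (l * α) (l * β) (l * γ) = hs α β γ := by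
  ext x
  rw [mem_hs, mem_hs, show l * α * x 0 + l * β * x 1 = l * (α * x 0 + β * x 1) by ring]
  exact mul_lt_mul_iff_right₀ hl

theorem HP_iff {x : M} : HP x ↔ ∃ α β γ : ℚ, (α ≠ 0 ∨ β ≠ 0) ∧ x = H α β γ := by
  constructor
  swap
  · rintro ⟨α, β, γ, h, rfl⟩
    exact HP_H h
  intro h
  obtain ⟨α, β, γ, hne, hx⟩ := HP_real h
  obtain ⟨S, hS, hS', hS''⟩ := frontier_lines x.2
  have h2 : 0 < α ^ 2 + β ^ 2 := by
    rcases hne with h | h <;> positivity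
  -- points on the line
  let P : ℝ → (Fin 2 → ℝ) := fun t =>
    ![γ / (α ^ 2 + β ^ 2) * α - t * β, γ / (α ^ 2 + β ^ 2) * β + t * α]
  have hP : ∀ t, α * P t 0 + β * P t 1 = γ := by
    intro t
    simp only [P, Matrix.cons_val_zero, Matrix.cons_val_one]
    field_simp
    ring
  have hPf : ∀ t, P t ∈ frontier x.1 := by
    intro t
    rw [(inROQ_open x.2).frontier_eq]
    constructor
    · rw [closure_eq_compl_interior_compl, hx, interior_compl_hs hne, Set.mem_compl_iff, mem_hs]
      have := hP t
      linarith
    · rw [hx, mem_hs, hP]; exact lt_irrefl _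
  have hch : ∀ t, ∃ p : S, P t ∈ ln p := by
    intro t
    have := hS'' (hPf t)
    simp only [Set.mem_iUnion] at this
    obtain ⟨p, hp, hm⟩ := this
    exact ⟨⟨p, hp⟩, hm⟩
  choose g hg using hch
  have : Finite S := hS
  obtain ⟨t, t', htt, hgt⟩ := Finite.exists_ne_map_eq_of_infinite g
  have e1 := hg t
  have e2 := hg t'
  rw [← hgt] at e2
  have hn := hS' _ (g t).2
  generalize g t = q at e1 e2 hn
  obtain ⟨⟨a, b, c⟩, hp⟩ := q
  simp only [ln, Set.mem_ofPred_eq, P, Matrix.cons_val_zero, Matrix.cons_val_one] at e1 e2 hn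
  -- `(a, b)` is proportional to `(α, β)`
  have e3 : (b : ℝ) * α = a * β := by
    have : (t - t') * ((b : ℝ) * α - a * β) = 0 := by linear_combination e1 - e2
    rcases mul_eq_zero.1 this with h | h
    · exact absurd (sub_eq_zero.1 h) htt
    · linarith
  set l : ℝ := (a * α + b * β) / (α ^ 2 + β ^ 2) with hl
  have la : (a : ℝ) = l * α := by
    rw [hl]; field_simp; linear_combination (-β) * e3
  have lb : (b : ℝ) = l * β := by
    rw [hl]; field_simp; linear_combination α * e3
  have lc : (c : ℝ) = l * γ := by
    have e4 := hP t
    simp only [P, Matrix.cons_val_zero, Matrix.cons_val_one] at e4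
    linear_combination (-1) * e1 + (γ / (α ^ 2 + β ^ 2) * α - t * β) * la
      + (γ / (α ^ 2 + β ^ 2) * β + t * α) * lb + l * e4
  have hl0 : l ≠ 0 := by
    intro h0
    rw [h0, zero_mul] at la lb
    rcases hn with h | h
    · exact h (by exact_mod_cast la)
    · exact h (by exact_mod_cast lb)
  rcases lt_or_gt_of_ne hl0 with hneg | hpos
  · refine ⟨-a, -b, -c, by simpa using hn, Subtype.ext ?_⟩
    rw [hx, ← hs_scale (neg_pos.2 hneg)]
    simp only [H]
    push_cast
    rw [la, lb, lc]
    congr 1 <;> ring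
  · refine ⟨a, b, c, hn, Subtype.ext ?_⟩
    rw [hx, ← hs_scale hpos]
    simp only [H]
    rw [la, lb, lc]

end geom

section constructions

/-- a rational point -/
def pt (p q : ℚ) : Fin 2 → ℝ := ![(p : ℝ), (q : ℝ)]

theorem pt_mem_H {α β γ p q : ℚ} : pt p q ∈ (H α β γ).1 ↔ α * p + β * q < γ := by
  rw [mem_H]; simp only [pt, Matrix.cons_val_zero, Matrix.cons_val_one]; exact_mod_cast Iff.rfl

theorem inf_ne_bot {a b : M} : inf a b ≠ bot ↔ (a.1 ∩ b.1).Nonempty := by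
  rw [Set.nonempty_iff_ne_empty, not_iff_not]
  exact ⟨fun h => congrArg Subtype.val h, fun h => Subtype.ext h⟩

theorem quad_ne {U : Set (Fin 2 → ℝ)} (hU : IsOpen U) {p q α β γ α' β' γ' : ℚ} (hP : pt p q ∈ U)
    (hdet : α * β' - β * α' ≠ 0) (h1 : α * p + β * q = γ) (h2 : α' * p + β' * q = γ') :
    ((U ∩ (H α β γ).1) ∩ (H α' β' γ').1).Nonempty := by
  have hd : (α : ℝ) * β' - β * α' ≠ 0 := by exact_mod_cast hdet
  have h1' : (α : ℝ) * p + β * q = γ := by exact_mod_cast h1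
  have h2' : (α' : ℝ) * p + β' * q = γ' := by exact_mod_cast h2
  obtain ⟨d, hdd⟩ : ∃ d : ℝ, d = α * β' - β * α' := ⟨_, rfl⟩
  rw [← hdd] at hd
  obtain ⟨t, ht, hm⟩ := open_move hU hP
    ![((-β' + β : ℝ)) / d, (-α + α' : ℝ) / d]
  refine ⟨_, ⟨hm, ?_⟩, ?_⟩
  · rw [mem_H]
    simp only [pt, Pi.add_apply, Pi.smul_apply, smul_eq_mul,
      Matrix.cons_val_zero, Matrix.cons_val_one]
    have : (α : ℝ) * (p + t * ((-β' + β) / d))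
      + β * (q + t * ((-α + α') / d)) = γ - t := by
      rw [← h1']; field_simp; rw [hdd]; ring
    linarith
  · rw [mem_H]
    simp only [pt, Pi.add_apply, Pi.smul_apply, smul_eq_mul,
      Matrix.cons_val_zero, Matrix.cons_val_one]
    have : (α' : ℝ) * (p + t * ((-β' + β) / d))
      + β' * (q + t * ((-α + α') / d)) = γ' - t := by
      rw [← h2']; field_simp; rw [hdd]; ring
    linarith

theorem quad_empty {p q α β γ α' β' γ' s t e : ℚ} (hs : s ≤ 0) (ht : t ≤ 0)
    (h1 : α * p + β * q = γ) (h2 : α' * p + β' * q = γ')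
    (hP : e ≤ (s * α + t * α') * p + (s * β + t * β') * q) :
    ¬ (((H (s * α + t * α') (s * β + t * β') e).1 ∩ (H α β γ).1) ∩ (H α' β' γ').1).Nonempty := by
  rintro ⟨x, ⟨hx1, hx2⟩, hx3⟩
  rw [mem_H] at hx1 hx2 hx3
  have hs' : (s : ℝ) ≤ 0 := by exact_mod_cast hs
  have ht' : (t : ℝ) ≤ 0 := by exact_mod_cast ht
  have h1' : (α : ℝ) * p + β * q = γ := by exact_mod_cast h1
  have h2' : (α' : ℝ) * p + β' * q = γ' := by exact_mod_cast h2
  have hP' : (e : ℝ) ≤ (s * α + t * α') * p + (s * β + t * β') * q := by exact_mod_cast hP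
  push_cast at hx1
  nlinarith [mul_le_mul_of_nonpos_left hx2.le hs', mul_le_mul_of_nonpos_left hx3.le ht']

variable {ι : Type} {F : ι → M}

/-- The point `(p, q)` is definable. -/
def DPt (F : ι → M) (p q : ℚ) : Prop := DC F (fun c => HP c ∧ pt p q ∈ c.1)

theorem meet {α β γ α' β' γ' p q : ℚ} (ha : De F (H α β γ)) (hb : De F (H α' β' γ'))
    (hdet : α * β' - β * α' ≠ 0) (h1 : α * p + β * q = γ) (h2 : α' * p + β' * q = γ') :
    DPt F p q := by
  have hne : α ≠ 0 ∨ β ≠ 0 := by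
    by_contra! h; apply hdet; rw [h.1, h.2]; ring
  have hne' : α' ≠ 0 ∨ β' ≠ 0 := by
    by_contra! h; apply hdet; rw [h.1, h.2]; ring
  have key : D F (fun v : Unit → M => HP (v ()) ∧
      inf (inf (v ()) (H α β γ)) (H α' β' γ') ≠ bot ∧
      inf (inf (v ()) (cpl (H α β γ))) (H α' β' γ') ≠ bot ∧
      inf (inf (v ()) (H α β γ)) (cpl (H α' β' γ')) ≠ bot ∧
      inf (inf (v ()) (cpl (H α β γ))) (cpl (H α' β' γ')) ≠ bot) := by
    have hv : T F (fun v : Unit → M => v ()) := T.var ()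
    have hA : T F (fun _ : Unit → M => H α β γ) := ha.T
    have hB : T F (fun _ : Unit → M => H α' β' γ') := hb.T
    exact (D.HP hv).and ((D.eq ((hv.inf hA).inf hB) T.bot).not.and
      ((D.eq ((hv.inf hA.cpl).inf hB) T.bot).not.and
      ((D.eq ((hv.inf hA).inf hB.cpl) T.bot).not.and
      (D.eq ((hv.inf hA.cpl).inf hB.cpl) T.bot).not)))
  refine key.congr (fun v => ?_)
  generalize v () = c
  rw [cpl_H hne, cpl_H hne']
  apply and_congr_right
  intro hc
  simp only [inf_ne_bot]
  constructor
  · rintro ⟨k1, k2, k3, k4⟩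
    by_contra hP
    obtain ⟨a, b, e, -, rfl⟩ := HP_iff.1 hc
    rw [pt_mem_H, not_lt] at hP
    obtain ⟨d, hdd⟩ : ∃ d : ℚ, d = α * β' - β * α' := ⟨_, rfl⟩
    rw [← hdd] at hdet
    obtain ⟨s, hs⟩ : ∃ s, s = (a * β' - b * α') / d := ⟨_, rfl⟩
    obtain ⟨t, ht⟩ : ∃ t, t = (α * b - β * a) / d := ⟨_, rfl⟩
    have ea : a = s * α + t * α' := by rw [hs, ht]; field_simp; rw [hdd]; ring
    have eb : b = s * β + t * β' := by rw [hs, ht]; field_simp; rw [hdd]; ring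
    have m1 : -α * p + -β * q = -γ := by linarith
    have m2 : -α' * p + -β' * q = -γ' := by linarith
    rcases le_total s 0 with hs0 | hs0 <;> rcases le_total t 0 with ht0 | ht0
    · refine quad_empty hs0 ht0 h1 h2 (e := e) ?_ ?_
      · rwa [← ea, ← eb]
      · rw [← ea, ← eb]; exact k1
    · refine quad_empty hs0 (neg_nonpos.2 ht0) h1 m2 (e := e) ?_ ?_
      · rwa [neg_mul_neg, neg_mul_neg, ← ea, ← eb]
      · rw [neg_mul_neg, neg_mul_neg, ← ea, ← eb]; exact k3
    · refine quad_empty (neg_nonpos.2 hs0) ht0 m1 h2 (e := e) ?_ ?_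
      · rwa [neg_mul_neg, neg_mul_neg, ← ea, ← eb]
      · rw [neg_mul_neg, neg_mul_neg, ← ea, ← eb]; exact k2
    · refine quad_empty (neg_nonpos.2 hs0) (neg_nonpos.2 ht0) m1 m2 (e := e) ?_ ?_
      · rwa [neg_mul_neg, neg_mul_neg, neg_mul_neg, neg_mul_neg, ← ea, ← eb]
      · rw [neg_mul_neg, neg_mul_neg, neg_mul_neg, neg_mul_neg, ← ea, ← eb]; exact k4
  · intro hP
    have ho := inROQ_open c.2
    have m1 : -α * p + -β * q = -γ := by linarith
    have m2 : -α' * p + -β' * q = -γ' := by linarith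
    refine ⟨quad_ne ho hP hdet h1 h2, quad_ne ho hP ?_ m1 h2, quad_ne ho hP ?_ h1 m2,
      quad_ne ho hP ?_ m1 m2⟩
    · intro h; apply hdet; linarith
    · intro h; apply hdet; linarith
    · intro h; apply hdet; linarith

/-- the point `(p, q)` lies on the boundary of `x` -/
def On (p q : ℚ) (x : M) : Prop :=
  HP x ∧ ¬ (HP x ∧ pt p q ∈ x.1) ∧ ¬ (HP (cpl x) ∧ pt p q ∈ (cpl x).1)

theorem DPt.on {p q : ℚ} (h : DPt F p q) : DC F (On p q) :=
  (D.HP (T.var ())).and ((DC.app h (T.var ())).not.and (DC.app h (T.var ()).cpl).not)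

theorem on_H {α β γ p q : ℚ} (h : α ≠ 0 ∨ β ≠ 0) : On p q (H α β γ) ↔ α * p + β * q = γ := by
  have h' : -α ≠ 0 ∨ -β ≠ 0 := by simpa using h
  simp only [On, cpl_H h, HP_H h, HP_H h', pt_mem_H, true_and, not_lt]
  constructor
  · rintro ⟨h1, h2⟩; linarith
  · intro h; constructor <;> linarith

theorem H_scale {α β γ l : ℚ} (hl : 0 < l) : H (l * α) (l * β) (l * γ) = H α β γ := by
  apply Subtype.ext
  have := hs_scale (α := α) (β := β) (γ := γ) (l := (l : ℝ)) (by exact_mod_cast hl)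
  simp only [H]
  push_cast
  exact this

theorem join0 {α β γ p q p' q' a b : ℚ} (h : α ≠ 0 ∨ β ≠ 0) (hP : DPt F p q) (hQ : DPt F p' q')
    (hne : p ≠ p' ∨ q ≠ q') (h1 : α * p + β * q = γ) (h2 : α * p' + β * q' = γ)
    (hR : DPt F a b) (hR' : α * a + β * b < γ) : De F (H α β γ) := by
  refine (hP.on.and (hQ.on.and hR)).congr (fun v => ?_)
  generalize v () = x
  constructor
  · rintro ⟨k1, k2, hx, k3⟩
    obtain ⟨α', β', γ', h', rfl⟩ := HP_iff.1 hx
    rw [on_H h'] at k1 k2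
    rw [pt_mem_H] at k3
    have hsq : 0 < (q - q') ^ 2 + (p' - p) ^ 2 := by
      rcases hne with hh | hh
      · have : p' - p ≠ 0 := fun e => hh (by linarith)
        positivity
      · have : q - q' ≠ 0 := fun e => hh (by linarith)
        positivity
    have hαβ : 0 < α ^ 2 + β ^ 2 := by
      rcases h with h | h <;> positivity
    -- both are multiples of the normal vector
    have e0 : α' * β = α * β' := by
      have z1 : α * (p - p') + β * (q - q') = 0 := by linarith
      have z2 : α' * (p - p') + β' * (q - q') = 0 := by linarith
      have a1 : (α' * β - α * β') * (p - p') = 0 := by linear_combination β * z2 - β' * z1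
      have a2 : (α' * β - α * β') * (q - q') = 0 := by linear_combination α' * z1 - α * z2
      by_contra hcon
      have hcon' : α' * β - α * β' ≠ 0 := sub_ne_zero.2 hcon
      rcases hne with hh | hh
      · exact hh (sub_eq_zero.1 ((mul_eq_zero.1 a1).resolve_left hcon'))
      · exact hh (sub_eq_zero.1 ((mul_eq_zero.1 a2).resolve_left hcon'))
    set l := (α' * α + β' * β) / (α ^ 2 + β ^ 2) with hl
    have la : α' = l * α := by rw [hl]; field_simp; linear_combination β * e0
    have lb : β' = l * β := by rw [hl]; field_simp; linear_combination (-α) * e0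
    have lc : γ' = l * γ := by rw [← k1, ← h1, la, lb]; ring
    have hl : 0 < l := by
      by_contra hl
      rw [la, lb, lc] at k3
      have := mul_le_mul_of_nonpos_left hR'.le (not_lt.1 hl)
      linarith
    rw [la, lb, lc, H_scale hl]
  · rintro rfl
    exact ⟨(on_H h).2 h1, (on_H h).2 h2, HP_H h, pt_mem_H.2 hR'⟩

theorem De.cpl {r : M} (h : De F r) : De F (cpl r) := De.of_T h.T.cpl

theorem join {α β γ p q p' q' : ℚ} (h00 : DPt F 0 0) (h10 : DPt F 1 0) (h01 : DPt F 0 1)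
    (h : α ≠ 0 ∨ β ≠ 0) (hP : DPt F p q) (hQ : DPt F p' q')
    (hne : p ≠ p' ∨ q ≠ q') (h1 : α * p + β * q = γ) (h2 : α * p' + β * q' = γ) :
    De F (H α β γ) := by
  have h' : -α ≠ 0 ∨ -β ≠ 0 := by simpa using h
  have hc : De F (H (-α) (-β) (-γ)) → De F (H α β γ) := by
    intro hd
    have := hd.cpl
    rwa [cpl_H h', neg_neg, neg_neg, neg_neg] at this
  have m1 : -α * p + -β * q = -γ := by linarith
  have m2 : -α * p' + -β * q' = -γ := by linarith
  rcases lt_trichotomy γ 0 with hg | hg | hg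
  · exact hc (join0 h' hP hQ hne m1 m2 h00 (by linarith))
  · subst hg
    rcases lt_trichotomy α 0 with ha | ha | ha
    · exact join0 h hP hQ hne h1 h2 h10 (by linarith)
    · subst ha
      rcases lt_trichotomy β 0 with hb | hb | hb
      · exact join0 h hP hQ hne h1 h2 h01 (by linarith)
      · exact absurd hb (by simpa using h)
      · exact hc (join0 h' hP hQ hne m1 m2 h01 (by linarith))
    · exact hc (join0 h' hP hQ hne m1 m2 h10 (by linarith))
  · exact join0 h hP hQ hne h1 h2 h00 (by linarith)

/-- inclusion of half-planes -/
theorem H_sub {α β γ α' β' γ' : ℚ} (h : α ≠ 0 ∨ β ≠ 0) (h' : α' ≠ 0 ∨ β' ≠ 0)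
    (hs : Leq (H α β γ) (H α' β' γ')) : ∃ l : ℚ, 0 < l ∧ α' = l * α ∧ β' = l * β := by
  have hαβ : 0 < α ^ 2 + β ^ 2 := by
    rcases h with h | h <;> positivity
  set l := (α' * α + β' * β) / (α ^ 2 + β ^ 2) with hl
  -- a rational point inside
  have hin : ∀ t m : ℚ, 0 ≤ m →
      (α' * α + β' * β) * ((γ - 1) / (α ^ 2 + β ^ 2) - m) + t * (α' * β - β' * α) < γ' := by
    intro t m hm
    have : pt (((γ - 1) / (α ^ 2 + β ^ 2) - m) * α + t * β)
        (((γ - 1) / (α ^ 2 + β ^ 2) - m) * β - t * α) ∈ (H α β γ).1 := by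
      rw [pt_mem_H]
      have : α * (((γ - 1) / (α ^ 2 + β ^ 2) - m) * α + t * β) +
          β * (((γ - 1) / (α ^ 2 + β ^ 2) - m) * β - t * α) = γ - 1 - m * (α ^ 2 + β ^ 2) := by
        field_simp; ring
      nlinarith [mul_nonneg hm hαβ.le]
    have := hs this
    rw [pt_mem_H] at this
    linarith
  have e0 : α' * β = α * β' := by
    by_contra hcon
    have hcon' : α' * β - β' * α ≠ 0 := fun e => hcon (by linarith)
    have := hin ((γ' - (α' * α + β' * β) * ((γ - 1) / (α ^ 2 + β ^ 2) - 0)) /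
      (α' * β - β' * α)) 0 le_rfl
    rw [div_mul_cancel₀ _ hcon'] at this
    linarith
  have la : α' = l * α := by rw [hl]; field_simp; linear_combination β * e0
  have lb : β' = l * β := by rw [hl]; field_simp; linear_combination (-α) * e0
  refine ⟨l, ?_, la, lb⟩
  have hl0 : l ≠ 0 := by
    rintro h0
    rw [h0, zero_mul] at la lb
    rcases h' with h' | h'
    · exact h' la
    · exact h' lb
  by_contra hlt
  have hlt : l < 0 := lt_of_le_of_ne (not_lt.1 hlt) hl0
  have hlt' : α' * α + β' * β < 0 := by
    have : α' * α + β' * β = l * (α ^ 2 + β ^ 2) := by rw [hl]; field_simp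
    rw [this]; exact mul_neg_of_neg_of_pos hlt hαβ
  set A := α' * α + β' * β
  have := hin 0 (|γ' - A * ((γ - 1) / (α ^ 2 + β ^ 2))| / (-A))
    (div_nonneg (abs_nonneg _) (by linarith))
  have e : A * (|γ' - A * ((γ - 1) / (α ^ 2 + β ^ 2))| / (-A)) =
    - |γ' - A * ((γ - 1) / (α ^ 2 + β ^ 2))| := by
    rw [div_neg, mul_neg, mul_div_cancel₀ _ hlt'.ne]
  rw [mul_sub, e] at this
  have := le_abs_self (γ' - A * ((γ - 1) / (α ^ 2 + β ^ 2)))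
  linarith

theorem H_mono {α β γ γ' : ℚ} (h : γ ≤ γ') : Leq (H α β γ) (H α β γ') := by
  intro x hx
  rw [mem_H] at *
  have : (γ : ℝ) ≤ γ' := by exact_mod_cast h
  linarith

theorem par {α β γ δ p q : ℚ} (h : α ≠ 0 ∨ β ≠ 0) (ha : De F (H α β γ)) (hP : DPt F p q)
    (h1 : α * p + β * q = δ) : De F (H α β δ) := by
  have hT : T F (fun _ : Unit → M => H α β γ) := ha.T
  refine (hP.on.and ((D.le (T.var ()) hT).or (D.le hT (T.var ())))).congr (fun v => ?_)
  dsimp only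
  generalize v () = x
  constructor
  · rintro ⟨k1, k2⟩
    obtain ⟨α', β', γ', h', rfl⟩ := HP_iff.1 k1.1
    rw [on_H h'] at k1
    have : ∃ l : ℚ, 0 < l ∧ α' = l * α ∧ β' = l * β := by
      rcases k2 with k2 | k2
      · obtain ⟨l, hl, e1, e2⟩ := H_sub h' h k2
        refine ⟨l⁻¹, inv_pos.2 hl, ?_, ?_⟩
        · rw [e1]; field_simp
        · rw [e2]; field_simp
      · exact H_sub h h' k2
    obtain ⟨l, hl, rfl, rfl⟩ := this
    have : γ' = l * δ := by rw [← k1, ← h1]; ring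
    rw [this, H_scale hl]
  · rintro rfl
    refine ⟨(on_H h).2 h1, ?_⟩
    rcases le_total δ γ with hh | hh
    · exact Or.inl (H_mono hh)
    · exact Or.inr (H_mono hh)

/-- The standard frame. -/
def F0 : Fin 4 → M := ![H 1 0 0, H 1 0 1, H 0 1 0, H 0 1 1]

theorem De.param (i : ι) : De F (F i) := De.of_T (T.par i)

theorem DPt_all (p q : ℚ) : DPt F0 p q ∧ DPt F0 0 0 ∧ DPt F0 1 0 ∧ DPt F0 0 1 := by
  have fx0 : De F0 (H 1 0 0) := De.param (F := F0) 0
  have fx1 : De F0 (H 1 0 1) := De.param (F := F0) 1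
  have fy0 : De F0 (H 0 1 0) := De.param (F := F0) 2
  have fy1 : De F0 (H 0 1 1) := De.param (F := F0) 3
  have h00 : DPt F0 0 0 := meet fx0 fy0 (by norm_num) (by norm_num) (by norm_num)
  have h10 : DPt F0 1 0 := meet fx1 fy0 (by norm_num) (by norm_num) (by norm_num)
  have h01 : DPt F0 0 1 := meet fx0 fy1 (by norm_num) (by norm_num) (by norm_num)
  have h11 : DPt F0 1 1 := meet fx1 fy1 (by norm_num) (by norm_num) (by norm_num)
  have diag : De F0 (H 1 (-1) 0) := join h00 h10 h01 (by norm_num) h00 h11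
    (by norm_num) (by norm_num) (by norm_num)
  have vert : ∀ {t u}, DPt F0 t u → De F0 (H 1 0 t) := fun ht =>
    par (by norm_num) fx0 ht (by ring)
  have hor : ∀ {t}, DPt F0 t 0 → De F0 (H 0 1 t) := by
    intro t ht
    have : DPt F0 t t := meet (vert ht) diag (by norm_num) (by ring) (by ring)
    exact par (by norm_num) fy0 this (by ring)
  have pts : ∀ {s t}, DPt F0 s 0 → DPt F0 t 0 → DPt F0 s t := by
    intro s t hs ht
    exact meet (vert hs) (hor ht) (by norm_num) (by ring) (by ring)
  have sub : ∀ {s t}, DPt F0 s 0 → DPt F0 t 0 → DPt F0 (s - t) 0 := by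
    intro s t hs ht
    have : De F0 (H 1 (-1) (s - t)) := par (by norm_num) diag (pts hs ht) (by ring)
    exact meet this fy0 (by norm_num) (by ring) (by ring)
  have div : ∀ {s t}, DPt F0 s 0 → DPt F0 t 0 → t ≠ 0 → DPt F0 (s / t) 0 := by
    intro s t hs ht h0
    have h1 : De F0 (H t (-s) 0) := join h00 h10 h01 (Or.inl h0) h00 (pts hs ht)
      (Or.inr h0.symm) (by ring) (by ring)
    have h2 : DPt F0 (s / t) 1 := meet h1 fy1 (by simpa using h0) (by field_simp; ring) (by ring)
    exact meet (vert h2) fy0 (by norm_num) (by ring) (by ring)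
  have add : ∀ {s t}, DPt F0 s 0 → DPt F0 t 0 → DPt F0 (s + t) 0 := by
    intro s t hs ht
    have := sub hs (sub h00 ht)
    rwa [zero_sub, sub_neg_eq_add] at this
  have nat : ∀ n : ℕ, DPt F0 n 0 := by
    intro n
    induction n with
    | zero => simpa using h00
    | succ n ih => push_cast; exact add ih h10
  have int : ∀ n : ℤ, DPt F0 n 0 := by
    intro n
    obtain ⟨m, rfl | rfl⟩ := n.eq_nat_or_neg
    · exact_mod_cast nat m
    · have := sub h00 (nat m)
      rw [zero_sub] at this
      push_cast; exact this
  have rat : ∀ r : ℚ, DPt F0 r 0 := by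
    intro r
    have := div (int r.num) (nat r.den) (by exact_mod_cast r.den_ne_zero)
    rwa [Rat.num_div_den] at this
  exact ⟨pts (rat p) (rat q), h00, h10, h01⟩

theorem De_H {α β : ℚ} (γ : ℚ) (h : α ≠ 0 ∨ β ≠ 0) : De F0 (H α β γ) := by
  obtain ⟨-, h00, h10, h01⟩ := DPt_all 0 0
  rcases h with h | h
  · exact join h00 h10 h01 (Or.inl h) (DPt_all (γ / α) 0).1 (DPt_all ((γ - β) / α) 1).1
      (Or.inr (by norm_num)) (by field_simp; ring) (by field_simp; ring)
  · exact join h00 h10 h01 (Or.inr h) (DPt_all 0 (γ / β)).1 (DPt_all 1 ((γ - α) / β)).1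
      (Or.inl (by norm_num)) (by field_simp; ring) (by field_simp; ring)

theorem De_all' {s : Set (Fin 2 → ℝ)} (h : InROQ 2 s) : De F0 ⟨s, h⟩ := by
  induction h with
  | bot => exact De.of_T T.bot
  | top => exact De.of_T T.top
  | halfspace s hs' =>
    obtain ⟨α, β, γ, h, e⟩ := exists_H hs'
    have : (⟨s, InROQ.halfspace s hs'⟩ : M) = H α β γ := Subtype.ext e
    rw [this]
    exact De_H γ h
  | inf s t hs ht h1 h2 => exact De.of_T (T.inf h1.T h2.T)
  | sup s t hs ht h1 h2 =>
    have : (⟨_, InROQ.sup s t hs ht⟩ : M) = cpl (inf (cpl ⟨s, hs⟩) (cpl ⟨t, ht⟩)) := by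
      apply Subtype.ext
      change interior (closure (s ∪ t)) = interior (interior sᶜ ∩ interior tᶜ)ᶜ
      rw [closure_eq_compl_interior_compl, Set.compl_union, interior_inter]
    rw [this]
    exact De.of_T (T.inf h1.T.cpl h2.T.cpl).cpl
  | compl s hs h1 => exact De.of_T h1.T.cpl

end constructions

section affine

open Matrix

/-- rational matrices as real matrices -/
noncomputable abbrev toR (A : Matrix (Fin 2) (Fin 2) ℚ) : Matrix (Fin 2) (Fin 2) ℝ :=
  (Rat.castHom ℝ).mapMatrix A

abbrev vR (b : Fin 2 → ℚ) : Fin 2 → ℝ := fun i => (b i : ℝ)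

/-- rational affine maps -/
noncomputable def aff (A : Matrix (Fin 2) (Fin 2) ℚ) (b : Fin 2 → ℚ) (x : Fin 2 → ℝ) : Fin 2 → ℝ :=
  (toR A).mulVec x + vR b

theorem aff_zero (A : Matrix (Fin 2) (Fin 2) ℚ) (b : Fin 2 → ℚ) (x : Fin 2 → ℝ) :
    aff A b x 0 = A 0 0 * x 0 + A 0 1 * x 1 + b 0 := by
  simp [aff]

theorem aff_one (A : Matrix (Fin 2) (Fin 2) ℚ) (b : Fin 2 → ℚ) (x : Fin 2 → ℝ) :
    aff A b x 1 = A 1 0 * x 0 + A 1 1 * x 1 + b 1 := by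
  simp [aff]

theorem vR_mulVec (A : Matrix (Fin 2) (Fin 2) ℚ) (b : Fin 2 → ℚ) :
    vR (A.mulVec b) = (toR A).mulVec (vR b) := by
  ext i
  simp [vR, Matrix.mulVec, dotProduct, Fin.sum_univ_two]

/-- translation part of the inverse -/
noncomputable def ib (A : Matrix (Fin 2) (Fin 2) ℚ) (b : Fin 2 → ℚ) : Fin 2 → ℚ := -(A⁻¹.mulVec b)

theorem vR_ib (A : Matrix (Fin 2) (Fin 2) ℚ) (b : Fin 2 → ℚ) :
    vR (ib A b) = -((toR A⁻¹).mulVec (vR b)) := by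
  rw [← vR_mulVec]; ext i; simp [vR, ib]

theorem aff_left {A : Matrix (Fin 2) (Fin 2) ℚ} (h : A.det ≠ 0) (b : Fin 2 → ℚ) (x : Fin 2 → ℝ) :
    aff A⁻¹ (ib A b) (aff A b x) = x := by
  have h' : IsUnit A.det := isUnit_iff_ne_zero.2 h
  unfold aff
  rw [vR_ib, Matrix.mulVec_add, Matrix.mulVec_mulVec, ← map_mul, Matrix.nonsing_inv_mul _ h',
    map_one, Matrix.one_mulVec, add_neg_cancel_right]

theorem aff_right {A : Matrix (Fin 2) (Fin 2) ℚ} (h : A.det ≠ 0) (b : Fin 2 → ℚ) (x : Fin 2 → ℝ) :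
    aff A b (aff A⁻¹ (ib A b) x) = x := by
  have h' : IsUnit A.det := isUnit_iff_ne_zero.2 h
  unfold aff
  rw [vR_ib, Matrix.mulVec_add, Matrix.mulVec_mulVec, ← map_mul, Matrix.mul_nonsing_inv _ h',
    map_one, Matrix.one_mulVec, Matrix.mulVec_neg, Matrix.mulVec_mulVec, ← map_mul,
    Matrix.mul_nonsing_inv _ h', map_one, Matrix.one_mulVec]
  simp

theorem aff_cont (A : Matrix (Fin 2) (Fin 2) ℚ) (b : Fin 2 → ℚ) : Continuous (aff A b) := by
  refine continuous_pi (fun i => ?_)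
  fin_cases i
  · simp only [Fin.zero_eta, aff_zero]; fun_prop
  · simp only [Fin.mk_one, aff_one]; fun_prop

/-- an affine homeomorphism -/
noncomputable def affH (A : Matrix (Fin 2) (Fin 2) ℚ) (b : Fin 2 → ℚ) (h : A.det ≠ 0) :
    (Fin 2 → ℝ) ≃ₜ (Fin 2 → ℝ) where
  toFun := aff A b
  invFun := aff A⁻¹ (ib A b)
  left_inv := aff_left h b
  right_inv := aff_right h b
  continuous_toFun := aff_cont _ _
  continuous_invFun := aff_cont _ _

theorem H_preimage (A : Matrix (Fin 2) (Fin 2) ℚ) (b : Fin 2 → ℚ) (α β γ : ℚ) :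
    aff A b ⁻¹' (H α β γ).1 = (H (α * A 0 0 + β * A 1 0) (α * A 0 1 + β * A 1 1)
      (γ - α * b 0 - β * b 1)).1 := by
  ext x
  rw [Set.mem_preimage, mem_H, mem_H, aff_zero, aff_one]
  push_cast
  constructor <;> intro h <;> linarith

theorem inROQ_preimage {A : Matrix (Fin 2) (Fin 2) ℚ} (b : Fin 2 → ℚ) (h : A.det ≠ 0)
    {s : Set (Fin 2 → ℝ)} (hs : InROQ 2 s) : InROQ 2 (aff A b ⁻¹' s) := by
  induction hs with
  | bot => exact InROQ.bot
  | top => exact InROQ.top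
  | halfspace s hs' =>
    obtain ⟨α, β, γ, -, rfl⟩ := exists_H hs'
    rw [H_preimage]
    exact Subtype.property _
  | inf s t _ _ h1 h2 => exact InROQ.inf _ _ h1 h2
  | sup s t _ _ h1 h2 =>
    have := InROQ.sup _ _ h1 h2
    rw [← Set.preimage_union] at this
    have e := (affH A b h).preimage_interior (closure (s ∪ t))
    rw [(affH A b h).preimage_closure] at e
    exact e ▸ this
  | compl s _ h1 =>
    have := InROQ.compl _ h1
    rw [← Set.preimage_compl] at this
    have e := (affH A b h).preimage_interior sᶜ
    exact e ▸ this

theorem convex_preimage (A : Matrix (Fin 2) (Fin 2) ℚ) (b : Fin 2 → ℚ) {s : Set (Fin 2 → ℝ)}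
    (hs : Convex ℝ s) : Convex ℝ (aff A b ⁻¹' s) := by
  intro x hx y hy u v hu hv huv
  have : aff A b (u • x + v • y) = u • aff A b x + v • aff A b y := by
    unfold aff
    rw [Matrix.mulVec_add, Matrix.mulVec_smul, Matrix.mulVec_smul, smul_add, smul_add]
    have : vR b = u • vR b + v • vR b := by rw [← add_smul, huv, one_smul]
    conv_lhs => rw [this]
    abel
  rw [Set.mem_preimage, this]
  exact hs hx hy hu hv huv

theorem pre_pre {A : Matrix (Fin 2) (Fin 2) ℚ} (h : A.det ≠ 0) (b : Fin 2 → ℚ)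
    (s : Set (Fin 2 → ℝ)) : aff A⁻¹ (ib A b) ⁻¹' (aff A b ⁻¹' s) = s := by
  ext x; simp only [Set.mem_preimage, aff_right h]

theorem pre_pre' {A : Matrix (Fin 2) (Fin 2) ℚ} (h : A.det ≠ 0) (b : Fin 2 → ℚ)
    (s : Set (Fin 2 → ℝ)) : aff A b ⁻¹' (aff A⁻¹ (ib A b) ⁻¹' s) = s := by
  ext x; simp only [Set.mem_preimage, aff_left h]

theorem det_inv_ne {A : Matrix (Fin 2) (Fin 2) ℚ} (h : A.det ≠ 0) : A⁻¹.det ≠ 0 := by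
  rw [Matrix.det_nonsing_inv, Ring.inverse_eq_inv']
  exact inv_ne_zero h

/-- The automorphism of 𝔐² induced by a rational affine map. -/
noncomputable def autM (A : Matrix (Fin 2) (Fin 2) ℚ) (b : Fin 2 → ℚ) (h : A.det ≠ 0) : M ≃[Lconv] M where
  toFun s := ⟨aff A b ⁻¹' s.1, inROQ_preimage b h s.2⟩
  invFun s := ⟨aff A⁻¹ (ib A b) ⁻¹' s.1, inROQ_preimage _ (det_inv_ne h) s.2⟩
  left_inv s := Subtype.ext (pre_pre h b s.1)
  right_inv s := Subtype.ext (pre_pre' h b s.1)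
  map_fun' := fun f _ => f.elim
  map_rel' := by
    intro n r x
    match n, r, x with
    | 1, _, x =>
      change Convex ℝ (aff A b ⁻¹' (x 0).1) ↔ Convex ℝ (x 0).1
      refine ⟨fun hc => ?_, convex_preimage A b⟩
      have := convex_preimage A⁻¹ (ib A b) hc
      rwa [pre_pre h] at this
    | 2, _, x =>
      change aff A b ⁻¹' (x 0).1 ⊆ aff A b ⁻¹' (x 1).1 ↔ (x 0).1 ⊆ (x 1).1
      refine ⟨fun hc => ?_, fun hc => Set.preimage_mono hc⟩
      have := Set.preimage_mono (f := aff A⁻¹ (ib A b)) hc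
      rwa [pre_pre h, pre_pre h] at this
    | 0, r, _ => exact r.elim
    | (_ + 3), r, _ => exact r.elim

/-- Frames: two parallel pairs of nested half-planes. -/
def Frame (v : Fin 4 → M) : Prop :=
  (HP (v 0) ∧ HP (v 1) ∧ HP (v 2) ∧ HP (v 3)) ∧
  ((Leq (v 0) (v 1) ∧ ¬ v 0 = v 1) ∧ (Leq (v 2) (v 3) ∧ ¬ v 2 = v 3)) ∧
  ¬ ((Leq (v 0) (v 2) ∨ Leq (v 2) (v 0)) ∨ (Leq (v 0) (cpl (v 2)) ∨ Leq (cpl (v 2)) (v 0)))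

theorem D_Frame {ι : Type} {F : ι → M} : D F Frame :=
  ((D.HP (T.var 0)).and ((D.HP (T.var 1)).and ((D.HP (T.var 2)).and (D.HP (T.var 3))))).and
  ((((D.le0 0 1).and (D.eq (T.var 0) (T.var 1)).not).and
    ((D.le0 2 3).and (D.eq (T.var 2) (T.var 3)).not)).and
  (((D.le0 0 2).or (D.le0 2 0)).or
    ((D.le (T.var 0) (T.var 2).cpl).or (D.le (T.var 2).cpl (T.var 0)))).not)

theorem H_cmp (α β γ γ' : ℚ) : Leq (H α β γ) (H α β γ') ∨ Leq (H α β γ') (H α β γ) := by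
  rcases le_total γ γ' with h | h
  · exact Or.inl (H_mono h)
  · exact Or.inr (H_mono h)

theorem pair_norm {x y : M} (hx : HP x) (hy : HP y) (h : Leq x y) (hne : ¬ x = y) :
    ∃ α β γ γ' : ℚ, (α ≠ 0 ∨ β ≠ 0) ∧ γ < γ' ∧ x = H α β γ ∧ y = H α β γ' := by
  obtain ⟨α, β, γ, h0, rfl⟩ := HP_iff.1 hx
  obtain ⟨α', β', γ', h0', rfl⟩ := HP_iff.1 hy
  obtain ⟨l, hl, rfl, rfl⟩ := H_sub h0 h0' h
  have e : H (l * α) (l * β) γ' = H α β (γ' / l) := by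
    rw [← H_scale (γ := γ' / l) hl, mul_div_cancel₀ _ hl.ne']
  rw [e] at h hne
  refine ⟨α, β, γ, γ' / l, h0, ?_, rfl, e⟩
  by_contra hh
  exact hne (leq_antisymm h (H_mono (not_lt.1 hh)))

theorem frame_std {v : Fin 4 → M} (h : Frame v) :
    ∃ (A : Matrix (Fin 2) (Fin 2) ℚ) (b : Fin 2 → ℚ), A.det ≠ 0 ∧
      ∀ i, (v i).1 = aff A b ⁻¹' (F0 i).1 := by
  obtain ⟨⟨h0, h1, h2, h3⟩, ⟨⟨h01, h01'⟩, ⟨h23, h23'⟩⟩, hnp⟩ := h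
  obtain ⟨α, β, γ, δ, hαβ, hγδ, e0, e1⟩ := pair_norm h0 h1 h01 h01'
  obtain ⟨α', β', γ', δ', hαβ', hγδ', e2, e3⟩ := pair_norm h2 h3 h23 h23'
  have hd : 0 < δ - γ := sub_pos.2 hγδ
  have hd' : 0 < δ' - γ' := sub_pos.2 hγδ'
  have hdet : α * β' - β * α' ≠ 0 := by
    intro hz
    apply hnp
    rw [e0, e2, cpl_H hαβ']
    have hsq : 0 < α ^ 2 + β ^ 2 := by
      rcases hαβ with h | h <;> positivity
    obtain ⟨l, hl⟩ : ∃ l, l = (α' * α + β' * β) / (α ^ 2 + β ^ 2) := ⟨_, rfl⟩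
    have la : α' = l * α := by rw [hl]; field_simp; linear_combination (-β) * hz
    have lb : β' = l * β := by rw [hl]; field_simp; linear_combination α * hz
    have hl0 : l ≠ 0 := by
      rintro h0
      rw [h0, zero_mul] at la lb
      rcases hαβ' with h' | h'
      · exact h' la
      · exact h' lb
    rcases lt_or_gt_of_ne hl0 with hneg | hpos
    · right
      have e : H (-α') (-β') (-γ') = H α β (γ' / l) := by
        rw [← H_scale (γ := γ' / l) (neg_pos.2 hneg), la, lb, neg_mul, neg_mul, neg_mul,
          mul_div_cancel₀ _ hl0]
      rw [e]
      exact H_cmp _ _ _ _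
    · left
      have e : H α' β' γ' = H α β (γ' / l) := by
        rw [← H_scale (γ := γ' / l) hpos, la, lb, mul_div_cancel₀ _ hl0]
      rw [e]
      exact H_cmp _ _ _ _
  refine ⟨!![(δ - γ)⁻¹ * α, (δ - γ)⁻¹ * β; (δ' - γ')⁻¹ * α', (δ' - γ')⁻¹ * β'],
    ![-((δ - γ)⁻¹ * γ), -((δ' - γ')⁻¹ * γ')], ?_, ?_⟩
  · rw [Matrix.det_fin_two_of]
    have : (δ - γ)⁻¹ * α * ((δ' - γ')⁻¹ * β') - (δ - γ)⁻¹ * β * ((δ' - γ')⁻¹ * α')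
      = (δ - γ)⁻¹ * (δ' - γ')⁻¹ * (α * β' - β * α') := by ring
    rw [this]
    exact mul_ne_zero (mul_ne_zero (inv_ne_zero hd.ne') (inv_ne_zero hd'.ne')) hdet
  · have f1 : 1 + (δ - γ)⁻¹ * γ = (δ - γ)⁻¹ * δ := by
      have := inv_mul_cancel₀ hd.ne'
      linarith
    have f3 : 1 + (δ' - γ')⁻¹ * γ' = (δ' - γ')⁻¹ * δ' := by
      have := inv_mul_cancel₀ hd'.ne'
      linarith
    intro i
    fin_cases i
    · change (v 0).1 = _ ⁻¹' (H 1 0 0).1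
      rw [e0, H_preimage, ← H_scale (inv_pos.2 hd)]
      simp
    · change (v 1).1 = _ ⁻¹' (H 1 0 1).1
      rw [e1, H_preimage, ← H_scale (inv_pos.2 hd), ← f1]
      simp
    · change (v 2).1 = _ ⁻¹' (H 0 1 0).1
      rw [e2, H_preimage, ← H_scale (inv_pos.2 hd')]
      simp
    · change (v 3).1 = _ ⁻¹' (H 0 1 1).1
      rw [e3, H_preimage, ← H_scale (inv_pos.2 hd'), ← f3]
      simp

theorem frame_F0 : Frame F0 := by
  have hx : (1 : ℚ) ≠ 0 ∨ (0 : ℚ) ≠ 0 := by norm_num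
  have hy : (0 : ℚ) ≠ 0 ∨ (1 : ℚ) ≠ 0 := by norm_num
  have hy' : (-0 : ℚ) ≠ 0 ∨ (-1 : ℚ) ≠ 0 := by norm_num
  refine ⟨⟨HP_H hx, HP_H hx, HP_H hy, HP_H hy⟩, ⟨⟨H_mono (by norm_num), ?_⟩,
    ⟨H_mono (by norm_num), ?_⟩⟩, ?_⟩
  · change ¬ H 1 0 0 = H 1 0 1
    intro e
    have : pt 0 0 ∈ (H 1 0 1).1 := pt_mem_H.2 (by norm_num)
    rw [← e, pt_mem_H] at this
    norm_num at this
  · change ¬ H 0 1 0 = H 0 1 1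
    intro e
    have : pt 0 0 ∈ (H 0 1 1).1 := pt_mem_H.2 (by norm_num)
    rw [← e, pt_mem_H] at this
    norm_num at this
  · change ¬ ((Leq (H 1 0 0) (H 0 1 0) ∨ Leq (H 0 1 0) (H 1 0 0)) ∨
      (Leq (H 1 0 0) (cpl (H 0 1 0)) ∨ Leq (cpl (H 0 1 0)) (H 1 0 0)))
    rw [cpl_H hy]
    rintro ((h | h) | (h | h))
    · obtain ⟨l, hl, e1, e2⟩ := H_sub hx hy h
      norm_num at e2
    · obtain ⟨l, hl, e1, e2⟩ := H_sub hy hx h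
      norm_num at e1
    · obtain ⟨l, hl, e1, e2⟩ := H_sub hx hy' h
      norm_num at e2
    · obtain ⟨l, hl, e1, e2⟩ := H_sub hy' hx h
      norm_num at e1

end affine

theorem main {k : ℕ} (r : Fin k → M) : ∃ φ : Lconv.Formula (Fin k), φ.Realize r ∧
    ∀ s : Fin k → M, φ.Realize s → ∃ (A : Matrix (Fin 2) (Fin 2) ℚ) (b : Fin 2 → ℚ), A.det ≠ 0 ∧
      ∀ i, (s i).1 = aff A b ⁻¹' (r i).1 := by
  have hr : ∀ i, ∃ φ : Lconv.Formula (Fin 4 ⊕ Unit), ∀ v : Unit → M,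
      φ.Realize (Sum.elim F0 v) ↔ v () = r i := fun i => De_all' (r i).2
  choose ψ hψ using hr
  obtain ⟨χ, hχ⟩ := D_Frame (F := (Empty.elim : Empty → M))
  let χ' : Lconv.Formula (Fin k ⊕ Fin 4) :=
    χ.relabel (Sum.elim Empty.elim Sum.inr)
  let ψ' : Fin k → Lconv.Formula (Fin k ⊕ Fin 4) := fun i =>
    (ψ i).relabel (Sum.elim Sum.inr (fun _ => Sum.inl i))
  let φ : Lconv.Formula (Fin k) :=
    Formula.iExs (Fin 4) (χ' ⊓ Formula.iInf ψ')
  have hφ : ∀ s : Fin k → M, φ.Realize s ↔ ∃ f : Fin 4 → M, Frame f ∧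
      ∀ i, (ψ i).Realize (Sum.elim f (fun _ : Unit => s i)) := by
    intro s
    rw [Formula.realize_iExs]
    refine exists_congr (fun f => ?_)
    rw [Formula.realize_inf, Formula.realize_iInf]
    refine and_congr ?_ (forall_congr' fun i => ?_)
    · rw [Formula.realize_relabel, ← hχ]
      have : Sum.elim s f ∘ (Sum.elim Empty.elim Sum.inr : Empty ⊕ Fin 4 → Fin k ⊕ Fin 4)
          = Sum.elim Empty.elim f := by
        funext x; rcases x with x | x
        · exact x.elim
        · rfl
      rw [this]
    · rw [Formula.realize_relabel]
      have : Sum.elim s f ∘ (Sum.elim Sum.inr (fun _ => Sum.inl i) :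
          Fin 4 ⊕ Unit → Fin k ⊕ Fin 4) = Sum.elim f (fun _ : Unit => s i) := by
        funext x; rcases x with x | x <;> rfl
      rw [this]
  refine ⟨φ, (hφ r).2 ⟨F0, frame_F0, fun i => (hψ i _).2 rfl⟩, fun s hs => ?_⟩
  obtain ⟨f, hf, hfs⟩ := (hφ s).1 hs
  obtain ⟨A, b, hA, hfA⟩ := frame_std hf
  refine ⟨A, b, hA, fun i => ?_⟩
  let g := autM A b hA
  have e : Sum.elim f (fun _ : Unit => s i) =
      g ∘ Sum.elim F0 (fun _ : Unit => g.symm (s i)) := by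
    funext x
    rcases x with x | x
    · exact Subtype.ext (hfA x)
    · exact (g.apply_symm_apply (s i)).symm
  have h1 := hfs i
  rw [e, StrongHomClass.realize_formula, hψ] at h1
  have h2 : s i = g (r i) := by rw [← h1]; exact (g.apply_symm_apply (s i)).symm
  rw [h2]
  rfl

end AffC

/-- Every k-tuple of regions of ROQ(ℝ^2) satisfies an affine-complete formula in 𝔐^2:
any two k-tuples satisfying it are related by a single affine transformation of ℝ^2. -/
theorem affine_complete_formula_tuples_dim2 (k : ℕ) (hk : 1 ≤ k)
    (r : Fin k → ROQel 2) :
    ∃ φ : Lconv.Formula (Fin k),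
      φ.Realize r ∧
      ∀ s s' : Fin k → ROQel 2, φ.Realize s → φ.Realize s' →
        ∃ τ : (Fin 2 → ℝ) → (Fin 2 → ℝ), IsAffineEquiv 2 τ ∧
          ∀ i, τ '' (s i).1 = (s' i).1 := by
  obtain ⟨φ, h1, h2⟩ := AffC.main r
  refine ⟨φ, h1, fun s s' hs hs' => ?_⟩
  obtain ⟨A, b, hA, e⟩ := h2 s hs
  obtain ⟨A', b', hA', e'⟩ := h2 s' hs'
  refine ⟨fun x => AffC.aff A'⁻¹ (AffC.ib A' b') (AffC.aff A b x), ?_, fun i => ?_⟩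
  · refine ⟨AffC.toR (A'⁻¹ * A), (AffC.toR A'⁻¹).mulVec (AffC.vR b) + AffC.vR (AffC.ib A' b'),
      ?_, fun x => ?_⟩
    · rw [← RingHom.map_det, isUnit_iff_ne_zero, Matrix.det_mul]
      simpa using And.intro hA' hA
    · simp only [AffC.aff]
      rw [Matrix.mulVec_add, Matrix.mulVec_mulVec, ← map_mul, add_assoc]
  · rw [e, e']
    ext y
    constructor
    · rintro ⟨x, hx, rfl⟩
      simpa only [Set.mem_preimage, AffC.aff_right hA'] using hx
    · intro hy
      refine ⟨AffC.aff A⁻¹ (AffC.ib A b) (AffC.aff A' b' y), ?_, ?_⟩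
      · simpa only [Set.mem_preimage, AffC.aff_right hA] using hy
      · simp only [AffC.aff_right hA, AffC.aff_left hA']
end
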